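/- arXiv:1003.5675 — 5 statements merged into one kernel-verified Lean document; each statement's English description precedes it below -/
import Mathlib

section
/- Let V be a linear subspace of Matₙ(K) (K any field) such that every matrix in V has rank at most r, where r = max over V of rank. Then dim V ≤ n·r. -/
namespace Matrix

variable {m n ι K : Type*} [Field K]

/-- `p` is the position of the lexicographically first nonzero entry of `A`. -/
def IsLeadingPos [LT m] [LT n] (A : Matrix m n K) (p : m × n) : Prop :=
  (∀ i < p.1, ∀ j, A i j = 0) ∧ (∀ j < p.2, A p.1 j = 0) ∧ A p.1 p.2 ≠ 0

theorem exists_isLeadingPos [LinearOrder m] [WellFoundedLT m] [LinearOrder n] [WellFoundedLT n]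
    {A : Matrix m n K} (hA : A ≠ 0) : ∃ p, A.IsLeadingPos p := by
  have hrow : {i | ∃ j, A i j ≠ 0}.Nonempty := by
    by_contra! h
    apply hA
    ext i j
    by_contra hij
    exact (Set.eq_empty_iff_forall_notMem.mp h i) ⟨j, hij⟩
  obtain ⟨i, hi, himin⟩ := wellFounded_lt.has_min _ hrow
  obtain ⟨j, hj, hjmin⟩ := wellFounded_lt.has_min {j | A i j ≠ 0} hi
  refine ⟨(i, j), fun a ha b => ?_, fun b hb => ?_, hj⟩
  · by_contra h
    exact himin a ⟨b, h⟩ ha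
  · by_contra h
    exact hjmin b h hb

open Classical in
/-- The dimension of a space of matrices is at most the number of leading positions of its
elements. -/
theorem finrank_le_card_isLeadingPos [LinearOrder m] [Fintype m] [LinearOrder n] [Fintype n]
    (V : Submodule K (Matrix m n K)) :
    Module.finrank K V ≤ (Finset.univ.filter fun p => ∃ A ∈ V, A.IsLeadingPos p).card := by
  set P := Finset.univ.filter fun p : m × n => ∃ A ∈ V, A.IsLeadingPos p
  let φ : V →ₗ[K] (P → K) :=
    { toFun := fun A p => A.1 p.1.1 p.1.2
      map_add' := fun _ _ => rfl
      map_smul' := fun _ _ => rfl }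
  have hφ : Function.Injective φ := by
    rw [injective_iff_map_eq_zero]
    intro A hA
    by_contra hne
    obtain ⟨p, hp⟩ := exists_isLeadingPos (A := A.1) (fun h => hne (Subtype.ext h))
    have hpP : p ∈ P := by simpa [P] using ⟨A.1, A.2, hp⟩
    exact hp.2.2 (congrFun hA ⟨p, hpP⟩)
  simpa using LinearMap.finrank_le_finrank_of_injective hφ

/-- If a square matrix is upper triangular with respect to some injective labelling of the indices,
with nonzero diagonal entries, then its determinant is nonzero. -/
theorem det_ne_zero_of_upperTriangular_of_injective [Fintype ι] [DecidableEq ι] [LinearOrder n]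
    {M : Matrix ι ι K} {c : ι → n} (hc : Function.Injective c)
    (hM : ∀ i j, c j < c i → M i j = 0) (hdiag : ∀ i, M i i ≠ 0) : M.det ≠ 0 := by
  let : LinearOrder ι := LinearOrder.lift' c hc
  have h : M.IsUpperTriangular := fun i j hij => hM i j hij
  have hdet : M.det = ∏ i, M i i := by
    convert det_of_isUpperTriangular h
  rw [hdet]
  exact Finset.prod_ne_zero_iff.mpr fun i _ => hdiag i

/-- If the leading positions of a family of matrices in `V` lie in distinct rows and columns, then
some element of `V` has a nonsingular submatrix on these rows and columns. -/
theorem exists_mem_det_submatrix_ne_zero [Fintype ι] [DecidableEq ι] {k : ℕ} [LinearOrder n]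
    (V : Submodule K (Matrix (Fin k) n K)) {p : ι → Fin k × n}
    (hrow : Function.Injective fun i => (p i).1) (hcol : Function.Injective fun i => (p i).2)
    {B : ι → Matrix (Fin k) n K} (hBV : ∀ i, B i ∈ V) (hB : ∀ i, (B i).IsLeadingPos (p i)) :
    ∃ C ∈ V, (C.submatrix (fun i => (p i).1) (fun i => (p i).2)).det ≠ 0 := by
  have key : ∀ t : ℕ, ∃ C ∈ V, (Matrix.of fun i j : ι =>
      if ((p i).1 : ℕ) < t then C (p i).1 (p j).2 else B i (p i).1 (p j).2).det ≠ 0 := by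
    intro t
    induction t with
    | zero =>
      refine ⟨0, V.zero_mem, det_ne_zero_of_upperTriangular_of_injective hcol ?_ ?_⟩
      · intro i j hij
        simpa using (hB i).2.1 _ hij
      · intro i
        simpa using (hB i).2.2
    | succ t ih =>
      obtain ⟨C, hC, hdet⟩ := ih
      by_cases ht : ∃ i₀, ((p i₀).1 : ℕ) = t
      · obtain ⟨i₀, hi₀⟩ := ht
        set M := Matrix.of fun i j : ι =>
          if ((p i).1 : ℕ) < t then C (p i).1 (p j).2 else B i (p i).1 (p j).2 with hM
        let w : ι → K := fun j => C (p i₀).1 (p j).2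
        have hother : ∀ i ≠ i₀, (((p i).1 : ℕ) ≤ t ↔ ((p i).1 : ℕ) < t) := by
          intro i hi
          have : ((p i).1 : ℕ) ≠ t := fun h => hi (hrow (Fin.ext (h.trans hi₀.symm)))
          omega
        have h₁ : (Matrix.of fun i j : ι => if ((p i).1 : ℕ) < t + 1 then C (p i).1 (p j).2
            else B i (p i).1 (p j).2) = M.updateRow i₀ w := by
          ext i j
          by_cases hi : i = i₀
          · subst hi
            simp [w, hi₀]
          · simp [hM, hi, hother i hi]
        have h₂ : (Matrix.of fun i j : ι => if ((p i).1 : ℕ) < t + 1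
            then (C + B i₀) (p i).1 (p j).2 else B i (p i).1 (p j).2) =
            M.updateRow i₀ (w + M i₀) := by
          ext i j
          by_cases hi : i = i₀
          · subst hi
            simp [w, hM, hi₀]
          · by_cases hlt : ((p i).1 : ℕ) < t
            · have h0 : B i₀ (p i).1 (p j).2 = 0 :=
                (hB i₀).1 _ (Fin.lt_def.mpr (hi₀ ▸ hlt)) _
              simp [hM, hi, hother i hi, h0]
            · simp [hM, hi, hother i hi, hlt]
        by_cases hw : (M.updateRow i₀ w).det = 0
        · refine ⟨C + B i₀, V.add_mem hC (hBV i₀), ?_⟩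
          rw [h₂, det_updateRow_add, hw, zero_add, updateRow_eq_self]
          exact hdet
        · exact ⟨C, hC, by rwa [h₁]⟩
      · push Not at ht
        refine ⟨C, hC, ?_⟩
        have hiff : ∀ i, (((p i).1 : ℕ) < t + 1 ↔ ((p i).1 : ℕ) < t) := fun i => by
          have := ht i
          omega
        simpa only [hiff] using hdet
  obtain ⟨C, hC, hdet⟩ := key k
  refine ⟨C, hC, ?_⟩
  simpa [submatrix] using hdet

theorem card_le_rank_of_det_submatrix_ne_zero [Fintype n] [Fintype ι] [DecidableEq ι]
    (A : Matrix m n K) (f : ι → m) (g : ι → n) (h : (A.submatrix f g).det ≠ 0) :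
    Fintype.card ι ≤ A.rank := by
  rw [← rank_of_isUnit _ ((isUnit_iff_isUnit_det _).mpr h.isUnit)]
  exact rank_submatrix_le A f g

end Matrix

/-- Flanders' dimension bound for linear subspaces: if every matrix in a linear
subspace `V` of `Matₙ(K)` has rank at most `r`, with `r` attained, then `dim V ≤ n·r`. -/
theorem stmt_5 (n r : ℕ) (K : Type*) [Field K]
    (V : Submodule K (Matrix (Fin n) (Fin n) K))
    (hle : ∀ A ∈ V, A.rank ≤ r) (hmax : ∃ A ∈ V, A.rank = r) :
    Module.finrank K V ≤ n * r := by
  classical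
  refine (Matrix.finrank_le_card_isLeadingPos V).trans ?_
  by_contra! hlt
  set P := Finset.univ.filter fun p : Fin n × Fin n => ∃ A ∈ V, A.IsLeadingPos p
  have : NeZero n := ⟨by
    rintro rfl
    obtain ⟨p, -⟩ := Finset.card_pos.mp ((Nat.zero_le _).trans_lt hlt)
    exact p.1.elim0⟩
  obtain ⟨d, -, hd⟩ := Finset.exists_lt_card_fiber_of_mul_lt_card_of_maps_to
    (s := P) (t := Finset.univ) (f := fun p => p.2 - p.1) (n := r) (fun _ _ => Finset.mem_univ _)
    (by simpa using hlt)
  set F := P.filter fun p => p.2 - p.1 = d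
  have hdiag : ∀ p : F, p.1.2 - p.1.1 = d := fun p => (Finset.mem_filter.mp p.2).2
  have hlead : ∀ p : F, ∃ A ∈ V, A.IsLeadingPos p.1 := fun p =>
    (Finset.mem_filter.mp (Finset.mem_filter.mp p.2).1).2
  choose B hBV hB using hlead
  have hrow : Function.Injective fun p : F => p.1.1 := by
    intro p q (hpq : p.1.1 = q.1.1)
    have h := (hdiag p).trans (hdiag q).symm
    rw [hpq] at h
    exact Subtype.ext (Prod.ext hpq (sub_left_injective h))
  have hcol : Function.Injective fun p : F => p.1.2 := by
    intro p q (hpq : p.1.2 = q.1.2)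
    have h := (hdiag p).trans (hdiag q).symm
    rw [hpq] at h
    exact Subtype.ext (Prod.ext (sub_right_injective h) hpq)
  obtain ⟨C, hC, hdet⟩ := Matrix.exists_mem_det_submatrix_ne_zero V hrow hcol hBV hB
  have hcard := Matrix.card_le_rank_of_det_submatrix_ne_zero C _ _ hdet
  rw [Fintype.card_coe] at hcard
  exact absurd (hcard.trans (hle C hC)) (not_le.mpr hd)
end

section
/- Let K be any field and V an affine subspace of Matₙ(K) such that every matrix in V has rank at most r (with r the maximum rank attained on V). Then dim V ≤ n·r. -/
open Finset in
/-- Polarization of the determinant along an affine family: if `B + ∑ t ∈ X, A t` is singular for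
every `X`, the determinants mixing the rows of `B` (index `none`) and of the `A t` (index `some t`)
sum to zero over all choices of rows that use every `A t`. -/
theorem Matrix.sum_det_option_elim_eq_zero {ι R : Type*} [Fintype ι] [DecidableEq ι] [CommRing R]
    (B : Matrix ι ι R) (A : ι → Matrix ι ι R)
    (h : ∀ X : Finset ι, (B + ∑ t ∈ X, A t).det = 0) :
    ∑ f : ι → Option ι with ∀ t, ∃ i, f i = some t,
      Matrix.det (fun i => (f i).elim (B i) fun t => A t i) = 0 := by
  classical
  set D : (ι → Option ι) → R := fun f => Matrix.det (fun i => (f i).elim (B i) fun t => A t i)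
    with hD
  have hdet (X : Finset ι) :
      (B + ∑ t ∈ X, A t).det = ∑ f : ι → Option ι with ∀ i, f i ∈ insertNone X, D f := by
    have key := (Matrix.detRowAlternating (n := ι) (R := R)).toMultilinearMap.map_sum_finset
      (fun i (o : Option ι) => o.elim (B i) fun t => A t i) (fun _ => insertNone X)
    have hrow : (fun i => ∑ o ∈ insertNone X, o.elim (B i) fun t => A t i)
        = B + ∑ t ∈ X, A t := by
      funext i j
      simp [Finset.sum_apply, Matrix.sum_apply]
    rw [hrow] at key
    refine Eq.trans key (Finset.sum_congr ?_ fun _ _ => rfl)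
    ext f
    simp [Fintype.mem_piFinset]
  have hsign (f : ι → Option ι) :
      ∑ X : Finset ι, (if ∀ i, f i ∈ insertNone X then (-1 : R) ^ #Xᶜ else 0)
        = if ∀ t, ∃ i, f i = some t then 1 else 0 := by
    have hprod := Fintype.prod_add (fun _ : ι => (1 : R))
      (fun t => if ∃ i, f i = some t then 0 else -1)
    have hl : ∏ t, ((1 : R) + if ∃ i, f i = some t then 0 else -1)
        = if ∀ t, ∃ i, f i = some t then 1 else 0 := by
      split_ifs with hf
      · exact Finset.prod_eq_one fun t _ => by simp [hf t]
      · obtain ⟨t, ht⟩ := not_forall.1 hf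
        exact Finset.prod_eq_zero (mem_univ t) (by simp [ht])
    rw [← hl, hprod]
    refine Finset.sum_congr rfl fun X _ => ?_
    rw [Finset.prod_const_one, one_mul]
    split_ifs with hX
    · rw [← Finset.prod_const]
      refine Finset.prod_congr rfl fun t ht => (if_neg ?_).symm
      rintro ⟨i, hi⟩
      exact Finset.mem_compl.1 ht (Finset.mem_insertNone.1 (hX i) t hi)
    · obtain ⟨i, hi⟩ := not_forall.1 hX
      rw [Finset.mem_insertNone] at hi
      push Not at hi
      obtain ⟨t, ht, htX⟩ := hi
      have hcov : ∃ i, f i = some t := ⟨i, ht⟩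
      symm
      exact Finset.prod_eq_zero (Finset.mem_compl.2 htX) (by rw [if_pos hcov])
  calc ∑ f : ι → Option ι with ∀ t, ∃ i, f i = some t, D f
      = ∑ f, (∑ X : Finset ι, (if ∀ i, f i ∈ insertNone X then (-1 : R) ^ #Xᶜ else 0)) * D f := by
        simp_rw [hsign, Finset.sum_filter, ite_mul, one_mul, zero_mul]
    _ = ∑ X : Finset ι, (-1 : R) ^ #Xᶜ * (B + ∑ t ∈ X, A t).det := by
        simp_rw [Finset.sum_mul, hdet, Finset.mul_sum, Finset.sum_filter]
        rw [Finset.sum_comm]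
        simp_rw [ite_mul, zero_mul]
    _ = 0 := by simp [h]

theorem Matrix.BlockTriangular.det_ne_zero_of_injective {ι α K : Type*} [Fintype ι] [DecidableEq ι]
    [LinearOrder α] [Field K] {M : Matrix ι ι K} {b : ι → α} (hM : M.BlockTriangular b)
    (hb : Function.Injective b) (hdiag : ∀ i, M i i ≠ 0) : M.det ≠ 0 := by
  rw [hM.det, Finset.prod_ne_zero_iff]
  intro a ha
  obtain ⟨i, -, rfl⟩ := Finset.mem_image.1 ha
  have : Subsingleton {j // b j = b i} :=
    ⟨fun x y => Subtype.ext (hb (x.2.trans y.2.symm))⟩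
  rw [Matrix.det_eq_elem_of_subsingleton _ ⟨i, rfl⟩]
  exact hdiag i

theorem Function.Injective.eq_id_of_le_comp {ι : Type*} [Finite ι] {w : ι → ℕ}
    (hw : Function.Injective w) {g : ι → ι} (hg : Function.Injective g)
    (hle : ∀ i, w i ≤ w (g i)) : g = id := by
  have := Fintype.ofFinite ι
  have hsum : ∑ i, w i = ∑ i, w (g i) :=
    ((Finite.injective_iff_bijective.1 hg).sum_comp w).symm
  have := (Finset.sum_eq_sum_iff_of_le fun i _ => hle i).1 hsum
  exact funext fun i => hw (this i (Finset.mem_univ i)).symm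

/-- If the leading entry of each `A t`, for the lexicographic order given by the row weight `w` and
the column weight `v`, is in position `(t, t)`, then every affine family directed by the `A t`
contains a nonsingular matrix. -/
theorem Matrix.exists_det_add_sum_ne_zero {ι K : Type*} [Fintype ι] [DecidableEq ι] [Field K]
    {w v : ι → ℕ} (hw : Function.Injective w) (hv : Function.Injective v)
    (B : Matrix ι ι K) (A : ι → Matrix ι ι K)
    (hrow : ∀ t i j, w i < w t → A t i j = 0) (hcol : ∀ t j, v j < v t → A t t j = 0)
    (hdiag : ∀ t, A t t t ≠ 0) : ∃ X : Finset ι, (B + ∑ t ∈ X, A t).det ≠ 0 := by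
  by_contra! h
  have hsum := Matrix.sum_det_option_elim_eq_zero B A h
  rw [Finset.sum_eq_single_of_mem some (by simp)] at hsum
  · refine Matrix.BlockTriangular.det_ne_zero_of_injective (b := v) ?_ hv hdiag hsum
    exact fun i j hij => hcol i j hij
  · intro f hf hne
    choose g hg using (Finset.mem_filter.1 hf).2
    have hginj : Function.Injective g := fun s t hst =>
      Option.some_injective _ (by rw [← hg s, ← hg t, hst])
    by_contra hD
    have hle : ∀ t, w t ≤ w (g t) := by
      intro t
      by_contra! hlt
      refine hD (Matrix.det_eq_zero_of_row_eq_zero (g t) fun j => ?_)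
      simp only [hg t, Option.elim_some]
      exact hrow t _ j hlt
    have hid := hw.eq_id_of_le_comp hginj hle
    exact hne (funext fun t => by simpa [hid] using hg t)

/-- `p` is the first nonzero position of `A` for the lexicographic order. -/
def Matrix.IsLeadingPosition {m n R : Type*} [LinearOrder m] [LinearOrder n] [Zero R]
    (A : Matrix m n R) (p : m × n) : Prop :=
  A p.1 p.2 ≠ 0 ∧ ∀ q : m × n, toLex q < toLex p → A q.1 q.2 = 0

theorem Matrix.exists_isLeadingPosition {m n R : Type*} [LinearOrder m] [LinearOrder n]
    [Finite m] [Finite n] [Zero R] {A : Matrix m n R} (hA : A ≠ 0) :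
    ∃ p, A.IsLeadingPosition p := by
  obtain ⟨i, j, hij⟩ : ∃ i j, A i j ≠ 0 := by
    by_contra! h
    exact hA (Matrix.ext h)
  obtain ⟨p, hp, hmin⟩ := Set.exists_min_image {p : m × n | A p.1 p.2 ≠ 0} toLex
    (Set.toFinite _) ⟨(i, j), hij⟩
  exact ⟨p, hp, fun q hq => by_contra fun hne => (hmin q hne).not_gt hq⟩

theorem Submodule.finrank_le_card_leadingPositions {m n K : Type*} [LinearOrder m] [LinearOrder n]
    [Finite m] [Finite n] [Field K] (W : Submodule K (Matrix m n K)) (S : Finset (m × n))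
    (hS : ∀ A ∈ W, ∀ p, A.IsLeadingPosition p → p ∈ S) : Module.finrank K W ≤ S.card := by
  let φ : W →ₗ[K] (S → K) :=
    { toFun := fun A p => (A : Matrix m n K) p.1.1 p.1.2
      map_add' := fun _ _ => rfl
      map_smul' := fun _ _ => rfl }
  have hφ : Function.Injective φ := by
    refine (injective_iff_map_eq_zero φ).2 fun A hA => ?_
    by_contra hne
    obtain ⟨p, hp⟩ := Matrix.exists_isLeadingPosition (fun h => hne (Subtype.ext h))
    exact hp.1 (congrFun hA ⟨p, hS A A.2 p hp⟩)
  simpa using LinearMap.finrank_le_finrank_of_injective hφ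

/-- Flanders' dimension bound for affine subspaces: if every matrix in a nonempty
affine subspace `V` of `Matₙ(K)` has rank at most `r`, with `r` attained, then
`dim V ≤ n·r`. -/
theorem stmt_6 (n r : ℕ) (K : Type*) [Field K]
    (V : AffineSubspace K (Matrix (Fin n) (Fin n) K)) (hne : (SetLike.coe V).Nonempty)
    (hle : ∀ A ∈ V, A.rank ≤ r) (hmax : ∃ A ∈ V, A.rank = r) :
    Module.finrank K V.direction ≤ n * r := by
  classical
  by_contra! hlt
  obtain ⟨B, hB⟩ := hne
  let S : Finset (Fin n × Fin n) :=
    Finset.univ.filter fun p => ∃ A ∈ V.direction, A.IsLeadingPosition p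
  have hS : n * r < S.card := hlt.trans_le <|
    V.direction.finrank_le_card_leadingPositions S fun A hA p hp =>
      Finset.mem_filter.2 ⟨Finset.mem_univ p, A, hA, hp⟩
  -- Some cyclic diagonal contains more than `r` leading positions.
  obtain ⟨c, -, hc⟩ := Finset.exists_lt_card_fiber_of_mul_lt_card_of_maps_to
    (s := S) (t := Finset.univ) (f := fun p => p.2 - p.1) (n := r)
    (fun _ _ => Finset.mem_univ _) (by simpa using hS)
  let F := S.filter fun p => p.2 - p.1 = c
  have hlead (p : F) : ∃ A ∈ V.direction, A.IsLeadingPosition p.1 :=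
    (Finset.mem_filter.1 (Finset.mem_filter.1 p.2).1).2
  choose A hA hAlead using hlead
  have hdiff (p : F) : p.1.2 - p.1.1 = c := (Finset.mem_filter.1 p.2).2
  have hw : Function.Injective fun p : F => (p.1.1 : ℕ) := by
    intro p q hpq
    have h1 : p.1.1 = q.1.1 := Fin.ext hpq
    have : NeZero n := ⟨fun h => by subst h; exact p.1.1.elim0⟩
    have h := (hdiff p).trans (hdiff q).symm
    rw [h1] at h
    exact Subtype.ext (Prod.ext h1 (sub_left_injective h))
  have hv : Function.Injective fun p : F => (p.1.2 : ℕ) := by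
    intro p q hpq
    have h2 : p.1.2 = q.1.2 := Fin.ext hpq
    have : NeZero n := ⟨fun h => by subst h; exact p.1.1.elim0⟩
    have h := (hdiff p).trans (hdiff q).symm
    rw [h2] at h
    exact Subtype.ext (Prod.ext (sub_right_injective h) h2)
  obtain ⟨X, hX⟩ := Matrix.exists_det_add_sum_ne_zero hw hv
    (B.submatrix (fun p : F => p.1.1) fun p : F => p.1.2)
    (fun t => (A t).submatrix (fun p : F => p.1.1) fun p : F => p.1.2)
    (fun t i j hij => (hAlead t).2 (i.1.1, j.1.2) (Prod.Lex.toLex_lt_toLex.2 (Or.inl hij)))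
    (fun t j hj => (hAlead t).2 (t.1.1, j.1.2) (Prod.Lex.toLex_lt_toLex.2 (Or.inr ⟨rfl, hj⟩)))
    (fun t => (hAlead t).1)
  have hmem : B + ∑ t ∈ X, A t ∈ V := by
    rw [add_comm]
    exact AffineSubspace.vadd_mem_of_mem_direction (Submodule.sum_mem _ fun t _ => hA t) hB
  have hsub : (B + ∑ t ∈ X, A t).submatrix (fun p : F => p.1.1) (fun p : F => p.1.2)
      = B.submatrix (fun p : F => p.1.1) (fun p : F => p.1.2)
        + ∑ t ∈ X, (A t).submatrix (fun p : F => p.1.1) (fun p : F => p.1.2) := by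
    ext i j
    simp [Matrix.sum_apply]
  rw [← hsub] at hX
  have hrank := Matrix.rank_of_isUnit _ ((Matrix.isUnit_iff_isUnit_det _).2 hX.isUnit)
  rw [Fintype.card_coe] at hrank
  have := (Matrix.rank_submatrix_le (B + ∑ t ∈ X, A t) (fun p : F => p.1.1)
    (fun p : F => p.1.2)).trans (hle _ hmem)
  exact absurd (hc.trans_le (hrank.symm.le.trans this)) (lt_irrefl r)
end

section
/- Let K be any field and V an affine subspace of Matₙ(K) of dimension n(n−1) consisting entirely of singular matrices. If n > 2 or |K| > 2 or V is a linear subspace, then V or its transpose Vᵗ is equivalent to the space of matrices with last column zero, i.e. there exist P, Q ∈ GLₙ(K) with P·V·Q (or P·Vᵗ·Q) equal to {[M | 0] : M ∈ Mat_{n,n−1}(K)}. -/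
namespace SingularSpace

open Matrix Module

variable {K : Type*} [Field K]

/-- `GLₙ(K)` acts transitively on linearly independent families of a given length. -/
theorem exists_isUnit_mulVec_eq {n : ℕ} {ι : Type*} [Finite ι] {v w : ι → Fin n → K}
    (hv : LinearIndependent K v) (hw : LinearIndependent K w) :
    ∃ G : Matrix (Fin n) (Fin n) K, IsUnit G ∧ ∀ i, G *ᵥ v i = w i := by
  have : FiniteDimensional K (Submodule.span K (Set.range v)) :=
    FiniteDimensional.span_of_finite K (Set.finite_range _)
  obtain ⟨g, hg⟩ := Submodule.exists_linearEquiv_restrict_eq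
    (hv.linearCombinationEquiv.symm ≪≫ₗ hw.linearCombinationEquiv)
  refine ⟨LinearMap.toMatrix' g.toLinearMap, ?_, fun i => ?_⟩
  · rw [Matrix.isUnit_iff_isUnit_det, LinearMap.det_toMatrix']
    exact g.isUnit_det'
  · have h1 := hg (hv.linearCombinationEquiv (Finsupp.single i 1))
    simp at h1
    simpa [LinearMap.toMatrix'_mulVec] using h1.symm

theorem exists_isUnit_mulVec_eq_of_ne_zero {n : ℕ} {v w : Fin n → K} (hv : v ≠ 0) (hw : w ≠ 0) :
    ∃ G : Matrix (Fin n) (Fin n) K, IsUnit G ∧ G *ᵥ v = w := by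
  obtain ⟨G, hG, h⟩ := exists_isUnit_mulVec_eq (ι := Unit) (v := fun _ => v) (w := fun _ => w)
    (LinearIndependent.of_subsingleton () hv) (LinearIndependent.of_subsingleton () hw)
  exact ⟨G, hG, h ()⟩

/-- Adding `E₀₀` to a matrix changes its determinant by the complementary minor. -/
theorem det_add_single_zero_zero {n : ℕ} (A : Matrix (Fin (n + 1)) (Fin (n + 1)) K) :
    (A + single 0 0 1).det = A.det + (A.submatrix Fin.succ Fin.succ).det := by
  rw [det_succ_column_zero, det_succ_column_zero A]
  have h1 (i : Fin (n + 1)) : (A + single 0 0 1).submatrix i.succAbove Fin.succ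
      = A.submatrix i.succAbove Fin.succ := by
    ext a b; simp [single, (Fin.succ_ne_zero _).symm]
  simp only [h1, Matrix.add_apply, mul_add, add_mul, Finset.sum_add_distrib]
  congr 1
  rw [Fin.sum_univ_succ]
  simp [single, (Fin.succ_ne_zero _).symm]

/-- The vectors `y` for which the rank-one matrix `y φᵗ` lies in `W`. -/
def colSpace {m n : ℕ} (W : Submodule K (Matrix (Fin m) (Fin n) K)) (φ : Fin n → K) :
    Submodule K (Fin m → K) :=
  W.comap ((vecMulVecBilin K K).flip φ)

/-- The vectors `φ` for which the rank-one matrix `y φᵗ` lies in `W`. -/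
def rowSpace {m n : ℕ} (W : Submodule K (Matrix (Fin m) (Fin n) K)) (y : Fin m → K) :
    Submodule K (Fin n → K) :=
  W.comap (vecMulVecBilin K K y)

theorem mem_colSpace {m n : ℕ} {W : Submodule K (Matrix (Fin m) (Fin n) K)} {φ : Fin n → K}
    {y : Fin m → K} : y ∈ colSpace W φ ↔ vecMulVec y φ ∈ W := Iff.rfl

theorem mem_rowSpace {m n : ℕ} {W : Submodule K (Matrix (Fin m) (Fin n) K)} {φ : Fin n → K}
    {y : Fin m → K} : φ ∈ rowSpace W y ↔ vecMulVec y φ ∈ W := Iff.rfl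

/-- If `p` vanishes on an embedded copy of `X`, then `W` meets that copy in a large subspace
whenever `p W` is small. -/
theorem finrank_add_finrank_le_of_range_le_ker {X E F : Type*} [AddCommGroup X] [Module K X]
    [AddCommGroup E] [Module K E] [FiniteDimensional K E] [AddCommGroup F] [Module K F]
    (p : E →ₗ[K] F) (W : Submodule K E) {L : X →ₗ[K] E} (hL : Function.Injective L)
    (hS : LinearMap.range L ≤ LinearMap.ker p) :
    finrank K X + finrank K W ≤
      finrank K (W.comap L) + finrank K (W.map p) + finrank K (LinearMap.ker p) := by
  have h1 := Submodule.finrank_sup_add_finrank_inf_eq W (LinearMap.range L)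
  have h2 := (p.domRestrict (W ⊔ LinearMap.range L)).finrank_range_add_finrank_ker
  have h3 : LinearMap.range (p.domRestrict (W ⊔ LinearMap.range L)) = W.map p := by
    rw [LinearMap.range_domRestrict, Submodule.map_sup, LinearMap.le_ker_iff_map.1 hS,
      sup_bot_eq]
  have h4 : finrank K (LinearMap.ker (p.domRestrict (W ⊔ LinearMap.range L)))
      ≤ finrank K (LinearMap.ker p) := by
    rw [LinearMap.ker_domRestrict, ← Submodule.finrank_map_subtype_eq,
      Submodule.map_comap_subtype]
    exact Submodule.finrank_mono inf_le_right
  have h5 : finrank K (W.comap L) = finrank K ↥(W ⊓ LinearMap.range L) := by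
    rw [inf_comm, ← Submodule.map_comap_eq]
    exact (Submodule.equivMapOfInjective L hL _).finrank_eq
  rw [h3] at h2
  rw [LinearMap.finrank_range_of_inj hL] at h1
  lia

/-- A space `W` of directions of a singular affine space which contains a rank-one matrix `y φᵗ`
compresses to a similar space of matrices of smaller size. -/
theorem exists_compression {n : ℕ} {W : Submodule K (Matrix (Fin (n + 1)) (Fin (n + 1)) K)}
    {A₀ : Matrix (Fin (n + 1)) (Fin (n + 1)) K} (hsing : ∀ w ∈ W, (A₀ + w).det = 0)
    {y φ : Fin (n + 1) → K} (hy : y ≠ 0) (hφ : φ ≠ 0) (hyφ : vecMulVec y φ ∈ W) :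
    ∃ (W' : Submodule K (Matrix (Fin n) (Fin n) K)) (A₁ : Matrix (Fin n) (Fin n) K),
      (∀ w ∈ W', (A₁ + w).det = 0) ∧
      finrank K W ≤ finrank K (colSpace W φ) + finrank K W' + n ∧
      finrank K W ≤ finrank K (rowSpace W y) + finrank K W' + n := by
  have he : (Pi.single 0 1 : Fin (n + 1) → K) ≠ 0 := by simp
  obtain ⟨P, hP, hPy⟩ := exists_isUnit_mulVec_eq_of_ne_zero hy he
  obtain ⟨R, hR, hRφ⟩ := exists_isUnit_mulVec_eq_of_ne_zero hφ he
  have hQ : IsUnit Rᵀ := (Matrix.isUnit_transpose _).2 hR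
  have hφQ : φ ᵥ* Rᵀ = Pi.single 0 1 := by rw [vecMul_transpose, hRφ]
  generalize Rᵀ = Q at hQ hφQ
  let p : Matrix (Fin (n + 1)) (Fin (n + 1)) K →ₗ[K] Matrix (Fin n) (Fin n) K :=
    { toFun := fun A => (P * A * Q).submatrix Fin.succ Fin.succ
      map_add' := fun A B => by rw [mul_add, add_mul]; rfl
      map_smul' := fun c A => by rw [Matrix.mul_smul, Matrix.smul_mul]; rfl }
  have hp (A) : p A = (P * A * Q).submatrix Fin.succ Fin.succ := rfl
  have hpv (u v : Fin (n + 1) → K) : p (vecMulVec u v) =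
      (vecMulVec (P *ᵥ u) (v ᵥ* Q)).submatrix Fin.succ Fin.succ := by
    rw [hp, mul_vecMulVec, vecMulVec_mul]
  have hsurj : Function.Surjective p := by
    intro B
    refine ⟨P⁻¹ * (Matrix.of fun i j => Fin.cases 0 (fun i' => Fin.cases 0 (B i') j) i) * Q⁻¹, ?_⟩
    rw [Matrix.isUnit_iff_isUnit_det] at hP hQ
    rw [hp, Matrix.mul_assoc, Matrix.nonsing_inv_mul_cancel_right _ _ hQ,
      Matrix.mul_nonsing_inv_cancel_left _ _ hP]
    ext i j
    simp
  have hker : finrank K (LinearMap.ker p) = 2 * n + 1 := by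
    have h1 := p.finrank_range_add_finrank_ker
    rw [LinearMap.range_eq_top.2 hsurj, finrank_top, finrank_matrix, finrank_matrix] at h1
    simp only [Fintype.card_fin, finrank_self] at h1
    linarith
  refine ⟨W.map p, p A₀, ?_, ?_, ?_⟩
  · rintro _ ⟨w, hw, rfl⟩
    rw [← map_add, hp]
    have h1 := det_add_single_zero_zero (P * (A₀ + w) * Q)
    have h2 : P * (A₀ + w) * Q + single 0 0 1 = P * (A₀ + (w + vecMulVec y φ)) * Q := by
      have h3 : P * vecMulVec y φ * Q = single 0 0 1 := by
        rw [mul_vecMulVec, vecMulVec_mul, hPy, hφQ, single_eq_single_vecMulVec_single]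
      rw [← h3]
      noncomm_ring
    rw [h2, det_mul, det_mul, hsing _ (W.add_mem hw hyφ), det_mul, det_mul, hsing _ hw] at h1
    simpa using h1.symm
  · have h1 := finrank_add_finrank_le_of_range_le_ker p W
      (L := (vecMulVecBilin K K).flip φ) ?_ ?_
    · rw [hker, finrank_fin_fun] at h1
      rw [colSpace]
      lia
    · rw [injective_iff_map_eq_zero]
      intro a ha
      simpa [hφ] using ha
    · rintro _ ⟨u, rfl⟩
      rw [LinearMap.mem_ker, LinearMap.flip_apply, vecMulVecBilin_apply_apply, hpv, hφQ]
      ext i j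
      simp [vecMulVec_apply]
  · have h1 := finrank_add_finrank_le_of_range_le_ker p W (L := vecMulVecBilin K K y) ?_ ?_
    · rw [hker, finrank_fin_fun] at h1
      rw [rowSpace]
      lia
    · rw [injective_iff_map_eq_zero]
      intro a ha
      simpa [hy] using ha
    · rintro _ ⟨u, rfl⟩
      rw [LinearMap.mem_ker, vecMulVecBilin_apply_apply, hpv, hPy]
      ext i j
      simp [vecMulVec_apply]

/-- A subspace containing all rank-one matrices is everything. -/
theorem eq_top_of_vecMulVec_mem {m n : ℕ} {W : Submodule K (Matrix (Fin m) (Fin n) K)}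
    (h : ∀ y φ, vecMulVec y φ ∈ W) : W = ⊤ := by
  refine eq_top_iff.2 fun A _ => ?_
  rw [matrix_eq_sum_single A]
  refine W.sum_mem fun i _ => W.sum_mem fun j _ => ?_
  have := W.smul_mem (A i j) (h (Pi.single i 1) (Pi.single j 1))
  rwa [← single_eq_single_vecMulVec_single, smul_single, smul_eq_mul, mul_one] at this

/-- A singular affine space of `n × n` matrices has dimension at most `n(n-1)`. -/
theorem finrank_le_of_det_eq_zero {n : ℕ} (W : Submodule K (Matrix (Fin n) (Fin n) K))
    (A₀ : Matrix (Fin n) (Fin n) K) (hsing : ∀ w ∈ W, (A₀ + w).det = 0) :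
    finrank K W ≤ n * (n - 1) := by
  induction n with
  | zero => simpa using hsing 0 W.zero_mem
  | succ n ih =>
    by_contra! hlt
    rw [Nat.add_sub_cancel] at hlt
    have htop : W = ⊤ := by
      refine eq_top_of_vecMulVec_mem fun y' φ => ?_
      rcases eq_or_ne φ 0 with rfl | hφ
      · simp
      rw [← mem_colSpace]
      suffices h : colSpace W φ = ⊤ by rw [h]; trivial
      have hinj : Function.Injective ((vecMulVecBilin K K (m := Fin (n + 1))).flip φ) := by
        rw [injective_iff_map_eq_zero]
        intro a ha
        simpa [hφ] using ha
      have hne : colSpace W φ ≠ ⊥ := by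
        intro h0
        have h1 := finrank_add_finrank_le_of_range_le_ker (0 : _ →ₗ[K] K) W hinj (by simp)
        rw [← colSpace, h0, finrank_bot, LinearMap.ker_zero, finrank_top, finrank_matrix,
          Submodule.map_zero, finrank_bot] at h1
        simp at h1
        lia
      obtain ⟨y, hy, hy0⟩ := Submodule.exists_mem_ne_zero_of_ne_bot hne
      obtain ⟨W', A₁, hW', h1, -⟩ := exists_compression hsing hy0 hφ hy
      have h2 := ih W' A₁ hW'
      refine Submodule.eq_top_of_finrank_eq (le_antisymm (Submodule.finrank_le _) ?_)
      rw [finrank_fin_fun]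
      cases n with
      | zero => rw [Nat.zero_mul] at h2; lia
      | succ n => rw [Nat.add_sub_cancel] at h2; lia
    have := hsing (1 - A₀) (htop ▸ trivial)
    simp at this

/-- In a subspace of codimension at most one, any two vectors are dependent modulo it. -/
theorem exists_sub_smul_mem {n : ℕ} {Z : Submodule K (Fin (n + 1) → K)} (hZ : n ≤ finrank K Z)
    {u : Fin (n + 1) → K} (hu : u ∉ Z) (v : Fin (n + 1) → K) : ∃ c : K, v - c • u ∈ Z := by
  have h1 : Z ⊔ Submodule.span K {u} = ⊤ := by
    refine Submodule.eq_top_of_finrank_eq (le_antisymm (Submodule.finrank_le _) ?_)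
    rw [finrank_fin_fun]
    have h2 : Z < Z ⊔ Submodule.span K {u} := by
      refine lt_of_le_of_ne le_sup_left fun h => hu ?_
      rw [h]
      exact Submodule.mem_sup_right (Submodule.mem_span_singleton_self u)
    have := Submodule.finrank_lt_finrank_of_lt h2
    lia
  have h2 : v ∈ Z ⊔ Submodule.span K {u} := h1 ▸ trivial
  obtain ⟨z, hz, w, hw, rfl⟩ := Submodule.mem_sup.1 h2
  obtain ⟨c, rfl⟩ := Submodule.mem_span_singleton.1 hw
  exact ⟨c, by simpa using hz⟩

/-- If all the `colSpace`s and `rowSpace`s of `W` have codimension at most one, then so has `W`. -/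
theorem le_finrank_of_colSpace_of_rowSpace {n : ℕ}
    (W : Submodule K (Matrix (Fin (n + 1)) (Fin (n + 1)) K))
    (hcol : ∀ φ, φ ≠ 0 → n ≤ finrank K (colSpace W φ))
    (hrow : ∀ y, y ≠ 0 → n ≤ finrank K (rowSpace W y)) :
    (n + 1) * (n + 1) ≤ finrank K W + 1 := by
  by_cases hall : ∀ y φ, vecMulVec y φ ∈ W
  · rw [eq_top_of_vecMulVec_mem hall, finrank_top, finrank_matrix]
    simp
  push Not at hall
  obtain ⟨y₀, φ₀, h₀⟩ := hall
  set T := W ⊔ Submodule.span K {vecMulVec y₀ φ₀} with hT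
  have hWT : W ≤ T := le_sup_left
  have hcolT {u v : Fin (n + 1) → K} {φ : Fin (n + 1) → K} (hu : vecMulVec u φ ∉ W)
      (huT : vecMulVec u φ ∈ T) : vecMulVec v φ ∈ T := by
    have hφ : φ ≠ 0 := by rintro rfl; simp at hu
    obtain ⟨c, hc⟩ := exists_sub_smul_mem (hcol φ hφ) (u := u) hu v
    rw [mem_colSpace, sub_vecMulVec, smul_vecMulVec] at hc
    simpa using T.add_mem (hWT hc) (T.smul_mem c huT)
  have hrowT {u v : Fin (n + 1) → K} {y : Fin (n + 1) → K} (hu : vecMulVec y u ∉ W)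
      (huT : vecMulVec y u ∈ T) : vecMulVec y v ∈ T := by
    have hy : y ≠ 0 := by rintro rfl; simp at hu
    obtain ⟨c, hc⟩ := exists_sub_smul_mem (hrow y hy) (u := u) hu v
    rw [mem_rowSpace, vecMulVec_sub, vecMulVec_smul] at hc
    simpa using T.add_mem (hWT hc) (T.smul_mem c huT)
  have h₀T : vecMulVec y₀ φ₀ ∈ T :=
    Submodule.mem_sup_right (Submodule.mem_span_singleton_self _)
  have htop : T = ⊤ := by
    refine eq_top_of_vecMulVec_mem fun y φ => ?_
    by_cases h1 : vecMulVec y φ₀ ∈ W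
    · have h2 : vecMulVec (y₀ + y) φ₀ ∉ W := by
        rw [add_vecMulVec]
        exact fun h => h₀ ((W.add_mem_iff_left h1).1 h)
      have h3 : vecMulVec (y₀ + y) φ ∈ T := hrowT h2 (hcolT h₀ h₀T)
      rw [add_vecMulVec] at h3
      exact (T.add_mem_iff_right (hrowT h₀ h₀T)).1 h3
    · exact hrowT h1 (hcolT h₀ h₀T)
  have h1 := Submodule.finrank_add_le_finrank_add_finrank W (Submodule.span K {vecMulVec y₀ φ₀})
  have h2 : finrank K (Submodule.span K {vecMulVec y₀ φ₀}) = 1 :=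
    finrank_span_singleton fun h => h₀ (h ▸ W.zero_mem)
  rw [← hT, htop, finrank_top, finrank_matrix] at h1
  simp at h1
  lia

/-- The direction of a singular affine space of dimension `n(n-1)` misses all rank-one matrices
with some given row space, or all those with some given column space. -/
theorem exists_forall_vecMulVec_mem {n : ℕ}
    {W : Submodule K (Matrix (Fin (n + 1)) (Fin (n + 1)) K)}
    {A₀ : Matrix (Fin (n + 1)) (Fin (n + 1)) K} (hsing : ∀ w ∈ W, (A₀ + w).det = 0)
    (hdim : finrank K W = (n + 1) * n) :
    (∃ φ ≠ 0, ∀ y, vecMulVec y φ ∈ W → y = 0) ∨ (∃ y ≠ 0, ∀ φ, vecMulVec y φ ∈ W → φ = 0) := by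
  by_contra! h
  obtain ⟨hc, hr⟩ := h
  have hn : n ≠ 0 := by
    rintro rfl
    obtain ⟨y, hy, hy0⟩ := hc 1 one_ne_zero
    have : W = ⊥ := Submodule.finrank_eq_zero.1 (by simpa using hdim)
    rw [this, Submodule.mem_bot, vecMulVec_eq_zero] at hy
    simp [hy0] at hy
  obtain ⟨m, rfl⟩ := Nat.exists_eq_succ_of_ne_zero hn
  have h1 := le_finrank_of_colSpace_of_rowSpace W (fun φ hφ => ?_) (fun y hy => ?_)
  · rw [hdim] at h1
    simp at h1
    lia
  · obtain ⟨y, hyφ, hy⟩ := hc φ hφ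
    obtain ⟨W', A₁, hW', h1, -⟩ := exists_compression hsing hy hφ hyφ
    have h2 := finrank_le_of_det_eq_zero W' A₁ hW'
    simp at h2 hdim
    lia
  · obtain ⟨φ, hyφ, hφ⟩ := hr y hy
    obtain ⟨W', A₁, hW', -, h1⟩ := exists_compression hsing hy hφ hyφ
    have h2 := finrank_le_of_det_eq_zero W' A₁ hW'
    simp at h2 hdim
    lia

theorem submatrix_castSucc_mulVec {m n : ℕ} (G : Matrix (Fin n) (Fin (m + 1)) K) (w : Fin m → K) :
    G.submatrix id Fin.castSucc *ᵥ w = G *ᵥ (Fin.snoc w 0 : Fin (m + 1) → K) := by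
  ext i
  simp [mulVec, dotProduct, Fin.sum_univ_castSucc]

theorem submatrix_castSucc_mulVec_injective {n : ℕ} {G : Matrix (Fin (n + 1)) (Fin (n + 1)) K}
    (hG : IsUnit G) : Function.Injective (G.submatrix id Fin.castSucc).mulVec := by
  intro v w h
  simp only [submatrix_castSucc_mulVec] at h
  exact Fin.snoc_left_injective (α := fun _ => K) 0 (Matrix.mulVec_injective_of_isUnit hG h)

theorem mulVec_single_last_ne {n : ℕ} {G : Matrix (Fin (n + 1)) (Fin (n + 1)) K}
    (hG : IsUnit G) (w : Fin n → K) :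
    G *ᵥ Pi.single (Fin.last n) 1 ≠ G.submatrix id Fin.castSucc *ᵥ w := by
  rw [submatrix_castSucc_mulVec]
  intro h
  simpa using congrFun (Matrix.mulVec_injective_of_isUnit hG h) (Fin.last n)

/-- A linear map of matrices acting on each column as a homothety is the evaluation at a vector. -/
theorem exists_forall_eq_mulVec {m n : ℕ}
    (f : Matrix (Fin n) (Fin m) K →ₗ[K] (Fin n → K))
    (h : ∀ j a, ¬ LinearIndependent K ![a, f (vecMulVec a (Pi.single j 1))]) :
    ∃ z, ∀ B, f B = B *ᵥ z := by
  have h1 (j : Fin m) : ∃ z : K, f ∘ₗ (vecMulVecBilin K K).flip (Pi.single j 1) = z • 1 :=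
    LinearMap.exists_eq_smul_id_of_forall_notLinearIndependent (h j)
  choose z hz using h1
  refine ⟨z, fun B => ?_⟩
  have hB : B = ∑ j, vecMulVec (B.col j) (Pi.single j 1) := by
    ext i j
    simp [Matrix.sum_apply, vecMulVec_apply, Pi.single_apply]
  have h2 (j : Fin m) (a : Fin n → K) : f (vecMulVec a (Pi.single j 1)) = z j • a :=
    LinearMap.congr_fun (hz j) a
  conv_lhs => rw [hB]
  rw [map_sum]
  simp only [h2]
  ext i
  simp [mulVec, dotProduct, mul_comm]

/-- If `c + f B` always lies in the column space of `B` for `B` of rank `m`, then the affine map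
`c + f` is the evaluation at a vector, provided `m ≥ 2`. -/
theorem exists_eq_mulVec_of_two_le {m : ℕ} (hm : 2 ≤ m)
    (f : Matrix (Fin (m + 1)) (Fin m) K →ₗ[K] (Fin (m + 1) → K)) (c : Fin (m + 1) → K)
    (hf : ∀ B, Function.Injective B.mulVec → ∃ v, c + f B = B *ᵥ v) :
    c = 0 ∧ ∃ z, ∀ B, f B = B *ᵥ z := by
  have hz : ∃ z, ∀ B, f B = B *ᵥ z := by
    refine exists_forall_eq_mulVec f fun j a hli => ?_
    have : Nontrivial (Fin m) := Fin.nontrivial_iff_two_le.2 hm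
    obtain ⟨i, hij⟩ := exists_ne j
    have hli' : LinearIndependent K
        ![(Pi.single i.castSucc 1 : Fin (m + 1) → K), Pi.single (Fin.last m) 1] := by
      rw [LinearIndependent.pair_iff]
      intro s t hst
      have h1 := congrFun hst i.castSucc
      have h2 := congrFun hst (Fin.last m)
      simp_all
    obtain ⟨G, hG, hGw⟩ := exists_isUnit_mulVec_eq hli' hli
    have hGi : G *ᵥ Pi.single i.castSucc 1 = a := hGw 0
    have hGl : G *ᵥ Pi.single (Fin.last m) 1 = f (vecMulVec a (Pi.single j 1)) := hGw 1
    set B := G.submatrix id Fin.castSucc with hB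
    have hBinj : Function.Injective B.mulVec := submatrix_castSucc_mulVec_injective hG
    have hBi : B *ᵥ Pi.single i 1 = a := by
      rw [← hGi]
      simp [hB, col_apply, funext_iff]
    have hB' (v : Fin m → K) : (B + vecMulVec a (Pi.single j 1)) *ᵥ v
        = B *ᵥ (v + v j • Pi.single i 1) := by
      rw [add_mulVec, vecMulVec_mulVec, mulVec_add, mulVec_smul, hBi]
      simp
    obtain ⟨v, hv⟩ := hf B hBinj
    obtain ⟨v', hv'⟩ := hf (B + vecMulVec a (Pi.single j 1)) (by
      intro v w hvw
      simp only [hB'] at hvw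
      have h1 := hBinj hvw
      have h2 : v j = w j := by simpa [hij.symm] using congrFun h1 j
      rw [h2] at h1
      exact add_right_cancel h1)
    rw [hB', map_add, ← add_assoc, hv, ← hGl] at hv'
    refine mulVec_single_last_ne hG (v' + v' j • Pi.single i 1 - v) ?_
    rw [← hB, mulVec_sub, ← hv', add_sub_cancel_left]
  obtain ⟨z, hz⟩ := hz
  refine ⟨?_, z, hz⟩
  by_contra hc
  obtain ⟨G, hG, hGw⟩ := exists_isUnit_mulVec_eq_of_ne_zero
    (v := (Pi.single (Fin.last m) 1 : Fin (m + 1) → K)) (by simp) hc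
  obtain ⟨v, hv⟩ := hf _ (submatrix_castSucc_mulVec_injective hG)
  refine mulVec_single_last_ne hG (v - z) ?_
  rw [mulVec_sub, ← hv, hz, hGw, add_sub_cancel_right]

theorem exists_eq_mulVec_of_fin_one
    (f : Matrix (Fin 2) (Fin 1) K →ₗ[K] (Fin 2 → K)) (c : Fin 2 → K)
    (hf : ∀ B, Function.Injective B.mulVec → ∃ v, c + f B = B *ᵥ v)
    (h : (∃ t : K, t ≠ 0 ∧ t ≠ 1) ∨ c = 0) :
    c = 0 ∧ ∃ z, ∀ B, f B = B *ᵥ z := by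
  have hcol (a : Fin 2 → K) (ha : a ≠ 0) :
      ∃ s : K, c + f (vecMulVec a (Pi.single 0 1)) = s • a := by
    obtain ⟨v, hv⟩ := hf (vecMulVec a (Pi.single 0 1)) (by
      intro v w hvw
      simp only [vecMulVec_mulVec] at hvw
      obtain ⟨i, hi⟩ := Function.ne_iff.1 ha
      ext k
      fin_cases k
      have h1 := congrFun hvw i
      simpa [show a i ≠ 0 from hi] using h1)
    refine ⟨v 0, ?_⟩
    rw [hv, vecMulVec_mulVec]
    simp
  have hc : c = 0 := by
    rcases h with ⟨t, ht0, ht1⟩ | hc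
    · by_contra hc
      obtain ⟨a, ha⟩ := exists_linearIndependent_pair_of_one_lt_finrank (R := K) (by simp) hc
      have ha0 : a ≠ 0 := ha.ne_zero 1
      obtain ⟨s, hs⟩ := hcol a ha0
      obtain ⟨s', hs'⟩ := hcol (t • a) (smul_ne_zero ht0 ha0)
      rw [smul_vecMulVec, map_smul] at hs'
      have h1 : (t - 1) • c + (s' * t - t * s) • a = 0 := by
        have : f (vecMulVec a (Pi.single 0 1)) = s • a - c := by rw [← hs]; abel
        rw [this] at hs'
        rw [← sub_eq_zero] at hs'
        rw [← neg_eq_zero, ← hs']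
        module
      have h2 := (LinearIndependent.pair_iff.1 ha _ _ h1).1
      exact ht1 (sub_eq_zero.1 h2)
    · exact hc
  refine ⟨hc, exists_forall_eq_mulVec f fun j a hli => ?_⟩
  obtain ⟨s, hs⟩ := hcol a (hli.ne_zero 0)
  rw [hc, zero_add] at hs
  rw [Subsingleton.elim j 0, hs] at hli
  have := LinearIndependent.pair_iff.1 hli s (-1) (by simp)
  simp at this

theorem exists_eq_mulVec {m : ℕ}
    (f : Matrix (Fin (m + 1)) (Fin m) K →ₗ[K] (Fin (m + 1) → K)) (c : Fin (m + 1) → K)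
    (hf : ∀ B, Function.Injective B.mulVec → ∃ v, c + f B = B *ᵥ v)
    (h : 2 ≤ m ∨ (∃ t : K, t ≠ 0 ∧ t ≠ 1) ∨ c = 0) :
    c = 0 ∧ ∃ z, ∀ B, f B = B *ᵥ z := by
  match m, f, c, hf, h with
  | 0, f, c, hf, _ =>
    have hf0 (B) : f B = 0 := by rw [Subsingleton.elim B 0, map_zero]
    obtain ⟨v, hv⟩ := hf 0 (Function.injective_of_subsingleton _)
    exact ⟨by simpa using hv, 0, fun B => by rw [hf0, mulVec_zero]⟩
  | 1, f, c, hf, h => exact exists_eq_mulVec_of_fin_one f c hf (h.resolve_left (by simp))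
  | m + 2, f, c, hf, _ => exact exists_eq_mulVec_of_two_le (by simp) f c hf

/-- If `W` misses the matrices supported on the last column, then the singular affine space
`A₀ + W` of dimension `n(n-1)` consists of the matrices that annihilate a given vector. -/
theorem exists_forall_mem_iff_of_last {m : ℕ}
    {W : Submodule K (Matrix (Fin (m + 1)) (Fin (m + 1)) K)}
    {A₀ : Matrix (Fin (m + 1)) (Fin (m + 1)) K} (hsing : ∀ w ∈ W, (A₀ + w).det = 0)
    (hdim : finrank K W = (m + 1) * m)
    (h : 2 ≤ m ∨ (∃ t : K, t ≠ 0 ∧ t ≠ 1) ∨ A₀ ∈ W)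
    (hlast : ∀ y, vecMulVec y (Pi.single (Fin.last m) 1) ∈ W → y = 0) :
    ∃ x ≠ 0, ∀ A, A - A₀ ∈ W ↔ A *ᵥ x = 0 := by
  let ρ : Matrix (Fin (m + 1)) (Fin (m + 1)) K →ₗ[K] Matrix (Fin (m + 1)) (Fin m) K :=
    { toFun := fun A => A.submatrix id Fin.castSucc
      map_add' := fun A B => rfl
      map_smul' := fun c A => rfl }
  have hρ (A) : ρ A = A.submatrix id Fin.castSucc := rfl
  have hρ0 {A} (hA : ρ A = 0) : A = vecMulVec (A.col (Fin.last m)) (Pi.single (Fin.last m) 1) := by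
    ext i j
    refine Fin.lastCases ?_ (fun j => ?_) j
    · simp [vecMulVec_apply]
    · rw [hρ] at hA
      simpa [vecMulVec_apply] using congrFun₂ hA i j
  have hρW {A} (hAW : A ∈ W) (hA : ρ A = 0) : A = 0 := by
    have h1 := hρ0 hA
    rw [h1] at hAW
    rw [h1, hlast _ hAW, zero_vecMulVec]
  have hinj : Function.Injective (ρ.domRestrict W) := by
    rw [injective_iff_map_eq_zero]
    rintro ⟨A, hAW⟩ hA
    exact Subtype.ext (hρW hAW hA)
  let σ := LinearEquiv.ofInjectiveOfFinrankEq (ρ.domRestrict W) hinj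
    (by rw [hdim, finrank_matrix]; simp)
  have hσ (B) : ρ (σ.symm B : Matrix _ _ K) = B := σ.apply_symm_apply B
  let col : Matrix (Fin (m + 1)) (Fin (m + 1)) K →ₗ[K] Fin (m + 1) → K :=
    { toFun := fun A => A.col (Fin.last m)
      map_add' := fun A B => rfl
      map_smul' := fun c A => rfl }
  let f := col ∘ₗ W.subtype ∘ₗ σ.symm.toLinearMap
  let A₁ := A₀ - σ.symm (ρ A₀)
  have hρA₁ : ρ A₁ = 0 := by simp [A₁, hσ]
  have hmem (A) : A - A₀ ∈ W ↔ A - A₁ ∈ W := by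
    have : A - A₁ = A - A₀ + σ.symm (ρ A₀) := by simp only [A₁]; abel
    rw [this, W.add_mem_iff_left (σ.symm (ρ A₀)).2]
  have hmem' (A) : A - A₀ ∈ W ↔ col A = col A₁ + f (ρ A) := by
    rw [hmem]
    constructor
    · intro hA
      have h1 : σ.symm (ρ A) = ⟨A - A₁, hA⟩ := by
        rw [LinearEquiv.symm_apply_eq]
        change ρ A = ρ (A - A₁)
        rw [map_sub, hρA₁, sub_zero]
      change _ = _ + col (σ.symm (ρ A))
      rw [h1, ← map_add]
      simp
    · intro hA
      have h1 : A = A₁ + σ.symm (ρ A) := by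
        have h2 : ρ (A - (A₁ + σ.symm (ρ A))) = 0 := by rw [map_sub, map_add, hρA₁, hσ]; simp
        have h3 : col (A - (A₁ + σ.symm (ρ A))) = 0 := by
          rw [map_sub, map_add, hA]; exact sub_self _
        have h4 := hρ0 h2
        change A - _ = vecMulVec (col _) _ at h4
        rw [h3, zero_vecMulVec] at h4
        exact sub_eq_zero.1 h4
      have h5 : A - A₁ = σ.symm (ρ A) := sub_eq_iff_eq_add'.2 h1
      rw [h5]
      exact (σ.symm (ρ A)).2
  have hmulVec (A : Matrix (Fin (m + 1)) (Fin (m + 1)) K) (x : Fin (m + 1) → K) :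
      A *ᵥ x = ρ A *ᵥ (fun i => x i.castSucc) + x (Fin.last m) • col A := by
    ext i
    simp only [mulVec, dotProduct, Fin.sum_univ_castSucc, hρ, Pi.add_apply, Pi.smul_apply,
      smul_eq_mul, submatrix_apply, id, mul_comm (x (Fin.last m))]
    rfl
  have hf (B : Matrix (Fin (m + 1)) (Fin m) K) (hB : Function.Injective B.mulVec) :
      ∃ v, col A₁ + f B = B *ᵥ v := by
    obtain ⟨A, hA, rfl⟩ : ∃ A, A - A₀ ∈ W ∧ ρ A = B := by
      refine ⟨A₁ + σ.symm B, ?_, by rw [map_add, hρA₁, hσ, zero_add]⟩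
      rw [hmem, add_sub_cancel_left]
      exact (σ.symm B).2
    have hdet : A.det = 0 := by simpa using hsing _ hA
    obtain ⟨v, hv, hAv⟩ := exists_mulVec_eq_zero_iff.2 hdet
    rw [hmem'] at hA
    rw [hmulVec, hA] at hAv
    have hl : v (Fin.last m) ≠ 0 := by
      intro hl
      rw [hl, zero_smul, add_zero] at hAv
      have h1 := hB (hAv.trans (mulVec_zero _).symm)
      apply hv
      ext i
      refine Fin.lastCases hl (fun i => congrFun h1 i) i
    refine ⟨-(v (Fin.last m))⁻¹ • fun i => v i.castSucc, ?_⟩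
    rw [mulVec_smul, eq_neg_of_add_eq_zero_left hAv, smul_neg, neg_smul, neg_neg, smul_smul,
      inv_mul_cancel₀ hl, one_smul]
  have h₀ : 2 ≤ m ∨ (∃ t : K, t ≠ 0 ∧ t ≠ 1) ∨ col A₁ = 0 := by
    refine h.imp_right (Or.imp_right fun hA₀ => ?_)
    have h1 : A₁ ∈ W := W.sub_mem hA₀ (σ.symm (ρ A₀)).2
    rw [hρW h1 hρA₁, map_zero]
  obtain ⟨hc, z, hz⟩ := exists_eq_mulVec f (col A₁) hf h₀
  refine ⟨Fin.snoc z (-1), fun h0 => by simpa using congrFun h0 (Fin.last m), fun A => ?_⟩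
  rw [hmem', hc, hz, hmulVec, zero_add]
  simp only [Fin.snoc_castSucc, Fin.snoc_last, neg_smul, one_smul, add_neg_eq_zero]
  exact eq_comm

/-- If `W` misses the rank-one matrices with row space `K φ`, then the singular affine space
`A₀ + W` of dimension `n(n-1)` consists of the matrices that annihilate a given vector. -/
theorem exists_forall_mem_iff {m : ℕ}
    {W : Submodule K (Matrix (Fin (m + 1)) (Fin (m + 1)) K)}
    {A₀ : Matrix (Fin (m + 1)) (Fin (m + 1)) K} (hsing : ∀ w ∈ W, (A₀ + w).det = 0)
    (hdim : finrank K W = (m + 1) * m)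
    (h : 2 ≤ m ∨ (∃ t : K, t ≠ 0 ∧ t ≠ 1) ∨ A₀ ∈ W)
    {φ : Fin (m + 1) → K} (hφ : φ ≠ 0) (hWφ : ∀ y, vecMulVec y φ ∈ W → y = 0) :
    ∃ x ≠ 0, ∀ A, A - A₀ ∈ W ↔ A *ᵥ x = 0 := by
  obtain ⟨R, hR, hRφ⟩ := exists_isUnit_mulVec_eq_of_ne_zero
    (w := (Pi.single (Fin.last m) 1 : Fin (m + 1) → K)) hφ (by simp)
  have hQ : IsUnit Rᵀ := (Matrix.isUnit_transpose _).2 hR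
  have hφQ : φ ᵥ* Rᵀ = Pi.single (Fin.last m) 1 := by rw [vecMul_transpose, hRφ]
  generalize Rᵀ = Q at hQ hφQ
  have hinj : Function.Injective (LinearMap.mulRight K Q) := hQ.mul_left_injective
  have hmem (A) : A * Q ∈ W.map (LinearMap.mulRight K Q) ↔ A ∈ W :=
    hinj.mem_set_image (s := (W : Set (Matrix (Fin (m + 1)) (Fin (m + 1)) K)))
  have hsing' : ∀ w ∈ W.map (LinearMap.mulRight K Q), (A₀ * Q + w).det = 0 := by
    rintro _ ⟨w, hw, rfl⟩
    rw [LinearMap.mulRight_apply, ← add_mul, det_mul, hsing w hw, zero_mul]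
  have hdim' : finrank K (W.map (LinearMap.mulRight K Q)) = (m + 1) * m := by
    rw [← hdim]
    exact (Submodule.equivMapOfInjective _ hinj W).finrank_eq.symm
  obtain ⟨x, hx, hxW⟩ := exists_forall_mem_iff_of_last hsing' hdim' (by rwa [hmem])
    (fun y hy => hWφ y (by rwa [← hφQ, ← vecMulVec_mul, hmem] at hy))
  refine ⟨Q *ᵥ x, fun h0 => hx (Matrix.mulVec_injective_of_isUnit hQ ?_), fun A => ?_⟩
  · simpa using h0
  · rw [← hmem, sub_mul, hxW, mulVec_mulVec]

/-- The matrices annihilating `x ≠ 0` form a space equivalent to that of the matrices with last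
column zero. -/
theorem exists_image_eq_last_col_zero {m : ℕ} {x : Fin (m + 1) → K} (hx : x ≠ 0) :
    ∃ Q : Matrix (Fin (m + 1)) (Fin (m + 1)) K, IsUnit Q ∧
      (fun A => 1 * A * Q) '' {A : Matrix (Fin (m + 1)) (Fin (m + 1)) K | A *ᵥ x = 0}
        = {A | ∀ i, A i (Fin.last m) = 0} := by
  obtain ⟨Q, hQ, hQx⟩ := exists_isUnit_mulVec_eq_of_ne_zero
    (v := (Pi.single (Fin.last m) 1 : Fin (m + 1) → K)) (by simp) hx
  refine ⟨Q, hQ, ?_⟩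
  have hiff (A : Matrix (Fin (m + 1)) (Fin (m + 1)) K) :
      A *ᵥ x = 0 ↔ ∀ i, (A * Q) i (Fin.last m) = 0 := by
    rw [← hQx, mulVec_mulVec, mulVec_single_one, funext_iff]
    rfl
  ext B
  constructor
  · rintro ⟨A, hA, rfl⟩
    simpa using (hiff A).1 hA
  · intro hB
    have hBQ : B * Q⁻¹ * Q = B :=
      Matrix.nonsing_inv_mul_cancel_right _ _ ((Matrix.isUnit_iff_isUnit_det _).1 hQ)
    refine ⟨B * Q⁻¹, (hiff _).2 ?_, by simpa using hBQ⟩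
    rw [hBQ]
    exact hB

end SingularSpace

/-- Dieudonné's theorem on maximal singular affine subspaces: a singular affine
subspace of `Matₙ(K)` of dimension `n(n-1)` is, up to equivalence and possibly
transposition, the space of matrices with last column zero — provided `n > 2`,
or `|K| > 2`, or the subspace is linear. -/
theorem stmt_7 (n : ℕ) (hn : 0 < n) (K : Type*) [Field K]
    (V : AffineSubspace K (Matrix (Fin n) (Fin n) K)) (hne : (SetLike.coe V).Nonempty)
    (hdim : Module.finrank K V.direction = n * (n - 1))
    (hsing : ∀ A ∈ V, A.det = 0)
    (h : 2 < n ∨ 2 < Cardinal.mk K ∨ (0 : Matrix (Fin n) (Fin n) K) ∈ V) :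
    ∃ P Q : Matrix (Fin n) (Fin n) K, IsUnit P ∧ IsUnit Q ∧
      ((fun A => P * A * Q) '' (SetLike.coe V)
          = {A : Matrix (Fin n) (Fin n) K | ∀ i, A i ⟨n - 1, Nat.sub_lt hn one_pos⟩ = 0} ∨
       (fun A => P * A.transpose * Q) '' (SetLike.coe V)
          = {A : Matrix (Fin n) (Fin n) K | ∀ i, A i ⟨n - 1, Nat.sub_lt hn one_pos⟩ = 0}) := by
  open SingularSpace Matrix in
  obtain ⟨m, rfl⟩ : ∃ m, n = m + 1 := ⟨n - 1, by lia⟩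
  obtain ⟨A₀, hA₀⟩ := hne
  have hV (A) : A ∈ V ↔ A - A₀ ∈ V.direction :=
    (AffineSubspace.vsub_right_mem_direction_iff_mem hA₀ A).symm
  have hs : ∀ w ∈ V.direction, (A₀ + w).det = 0 := fun w hw =>
    hsing _ ((hV _).2 (by rwa [add_sub_cancel_left]))
  rw [Nat.add_sub_cancel] at hdim
  have h' : 2 ≤ m ∨ (∃ t : K, t ≠ 0 ∧ t ≠ 1) ∨ A₀ ∈ V.direction := by
    refine h.imp (by lia) (Or.imp (fun hK => ?_) fun h0 => ?_)
    · refine Cardinal.exists_ne_ne_of_three_le ?_ 0 1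
      have := Order.succ_le_of_lt hK
      rwa [← Nat.cast_ofNat, Cardinal.succ_natCast, ← Nat.cast_succ] at this
    · rw [hV, zero_sub] at h0
      exact neg_mem_iff.1 h0
  rcases exists_forall_vecMulVec_mem hs hdim with ⟨φ, hφ, hφV⟩ | ⟨y, hy, hyV⟩
  · obtain ⟨x, hx, hxV⟩ := exists_forall_mem_iff hs hdim h' hφ hφV
    obtain ⟨Q, hQ, hQV⟩ := exists_image_eq_last_col_zero hx
    refine ⟨1, Q, isUnit_one, hQ, Or.inl ?_⟩
    have hVx : (V : Set (Matrix (Fin (m + 1)) (Fin (m + 1)) K)) = {A | A *ᵥ x = 0} :=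
      Set.ext fun A => (hV A).trans (hxV A)
    rw [hVx]
    exact hQV
  · let τ := transposeLinearEquiv (Fin (m + 1)) (Fin (m + 1)) K K
    have hτ (A : Matrix (Fin (m + 1)) (Fin (m + 1)) K) :
        A ∈ V.direction.map τ.toLinearMap ↔ Aᵀ ∈ V.direction :=
      Submodule.mem_map_equiv V.direction
    obtain ⟨x, hx, hxV⟩ := exists_forall_mem_iff (W := V.direction.map τ.toLinearMap) (A₀ := A₀ᵀ)
      (fun w hw => by
        rw [← det_transpose, transpose_add, transpose_transpose]
        exact hs _ ((hτ w).1 hw))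
      (by rw [← hdim]; exact LinearEquiv.finrank_map_eq τ _)
      (by rwa [hτ, transpose_transpose]) hy
      (fun φ hφ => hyV φ (by rwa [hτ, transpose_vecMulVec] at hφ))
    obtain ⟨Q, hQ, hQV⟩ := exists_image_eq_last_col_zero hx
    refine ⟨1, Q, isUnit_one, hQ, Or.inr ?_⟩
    have hVx : transpose '' (V : Set (Matrix (Fin (m + 1)) (Fin (m + 1)) K))
        = {A | A *ᵥ x = 0} := by
      ext A
      rw [Set.mem_ofPred_eq, ← hxV, hτ, transpose_sub, transpose_transpose, ← hV]
      constructor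
      · rintro ⟨B, hB, rfl⟩
        rwa [transpose_transpose]
      · exact fun hA => ⟨Aᵀ, hA, transpose_transpose A⟩
    rw [← hVx, Set.image_image] at hQV
    exact hQV
end

section
/- Let K be a field with n > 2 or |K| > 2. Every affine automorphism u of Matₙ(K) (bijective affine map) such that u(P) is invertible for every invertible P is a linear map (u(0) = 0). -/
section

open Module

namespace Matrix

variable {K : Type*} [Field K]

/-- A linear functional that vanishes on the kernel of a matrix-valued linear map factors through
this map by means of the trace pairing. -/
theorem exists_trace_mul_eq {E k m : Type*} [AddCommGroup E] [Module K E] [Fintype k] [Fintype m]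
    (p : E →ₗ[K] Matrix k m K) (g : E →ₗ[K] K) (h : LinearMap.ker p ≤ LinearMap.ker g) :
    ∃ N : Matrix m k K, ∀ e, trace (p e * N) = g e := by
  classical
  have hg : g ∈ LinearMap.range p.dualMap := by
    rw [LinearMap.range_dualMap_eq_dualAnnihilator_ker, Submodule.mem_dualAnnihilator]
    exact fun w hw => h hw
  obtain ⟨φ, rfl⟩ := hg
  refine ⟨of fun j i => φ (single i j 1), fun e => ?_⟩
  rw [LinearMap.dualMap_apply]
  conv_rhs => rw [matrix_eq_sum_single (p e)]
  simp only [trace, diag_apply, mul_apply, of_apply, map_sum]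
  refine Finset.sum_congr rfl fun i _ => Finset.sum_congr rfl fun j _ => ?_
  rw [← mul_one (p e i j), ← smul_eq_mul (p e i j) 1, ← smul_single, map_smul]
  simp

theorem exists_linearEquiv_apply_eq {V : Type*} [AddCommGroup V] [Module K V] {x y : V}
    (hx : x ≠ 0) (hy : y ≠ 0) : ∃ e : V ≃ₗ[K] V, e x = y := by
  obtain ⟨e, he⟩ := Submodule.exists_linearEquiv_restrict_eq
    ((LinearEquiv.toSpanNonzeroSingleton K V x hx).symm ≪≫ₗ
      LinearEquiv.toSpanNonzeroSingleton K V y hy)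
  refine ⟨e, ?_⟩
  have h := he ⟨x, Submodule.mem_span_singleton_self x⟩
  rw [← h, LinearEquiv.trans_apply, LinearEquiv.coord_self, LinearEquiv.toSpanNonzeroSingleton_one]

theorem exists_isUnit_mulVec_eq {m : Type*} [Fintype m] [DecidableEq m] {x y : m → K}
    (hx : x ≠ 0) (hy : y ≠ 0) : ∃ G : Matrix m m K, IsUnit G ∧ G *ᵥ x = y := by
  obtain ⟨e, he⟩ := exists_linearEquiv_apply_eq (K := K) hx hy
  refine ⟨LinearMap.toMatrix' (e : (m → K) →ₗ[K] m → K), ?_, by simpa using he⟩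
  refine IsUnit.of_mul_eq_one (LinearMap.toMatrix' (e.symm : (m → K) →ₗ[K] m → K)) ?_
  rw [← LinearMap.toMatrix'_comp]
  simp

/-- Every nonzero vector is the first column of an invertible matrix. -/
theorem exists_invertible_first_col {n : ℕ} {x : Fin (n + 1) → K} (hx : x ≠ 0) :
    ∃ (P : Matrix (Fin (n + 1)) (Unit ⊕ Fin n) K) (P' : Matrix (Unit ⊕ Fin n) (Fin (n + 1)) K),
      P * P' = 1 ∧ P' * P = 1 ∧ P *ᵥ Pi.single (Sum.inl ()) 1 = x := by
  let e₀ : (Unit ⊕ Fin n → K) ≃ₗ[K] (Fin (n + 1) → K) :=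
    LinearEquiv.ofFinrankEq _ _ (by simp [add_comm])
  obtain ⟨e₁, he₁⟩ := exists_linearEquiv_apply_eq (K := K)
    (x := e₀ (Pi.single (Sum.inl ()) 1)) (by simp) hx
  let e := e₀ ≪≫ₗ e₁
  refine ⟨LinearMap.toMatrix' e.toLinearMap, LinearMap.toMatrix' e.symm.toLinearMap, ?_, ?_, ?_⟩
  · rw [← LinearMap.toMatrix'_comp]; simp
  · rw [← LinearMap.toMatrix'_comp]; simp
  · rw [LinearMap.toMatrix'_mulVec]; exact he₁

theorem isUnit_mul_mul {k m : Type*} [Fintype k] [DecidableEq k] [Fintype m] [DecidableEq m]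
    {P Q : Matrix k m K} {P' Q' : Matrix m k K} {B : Matrix m m K} (hP : P * P' = 1)
    (hQ : Q' * Q = 1) (hB : IsUnit B) : IsUnit (P * B * Q') := by
  obtain ⟨B', hB'⟩ := hB.exists_right_inv
  refine IsUnit.of_mul_eq_one (Q * B' * P') ?_
  calc P * B * Q' * (Q * B' * P') = P * (B * (Q' * Q) * B') * P' := by simp only [Matrix.mul_assoc]
    _ = 1 := by rw [hQ, Matrix.mul_one, hB', Matrix.mul_one, hP]

theorem trace_mul_fromBlocks {l m : Type*} [Fintype l] [Fintype m]
    (X : Matrix (l ⊕ m) (l ⊕ m) K) (a : Matrix l l K) (r : Matrix l m K) (c : Matrix m l K)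
    (N : Matrix m m K) :
    trace (X * fromBlocks a r c N) = trace (X.toBlocks₁₁ * a) + trace (X.toBlocks₁₂ * c) +
      (trace (X.toBlocks₂₁ * r) + trace (X.toBlocks₂₂ * N)) := by
  conv_lhs => rw [← fromBlocks_toBlocks X, fromBlocks_multiply]
  rw [← trace_add, ← trace_add]
  simp only [trace, diag_apply, Fintype.sum_sum_type, fromBlocks_apply₁₁, fromBlocks_apply₂₂]

theorem trace_mul_conj {k m : Type*} [Fintype k] [Fintype m] (A : Matrix k k K)
    (P : Matrix k m K) (B : Matrix m m K) (Q : Matrix m k K) :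
    trace (A * (P * B * Q)) = trace (Q * A * P * B) := by
  rw [← Matrix.mul_assoc, trace_mul_comm]
  simp only [Matrix.mul_assoc]

theorem trace_vecMulVec_mul {k : Type*} [Fintype k] (x φ : k → K) (C : Matrix k k K) :
    trace (vecMulVec x φ * C) = φ ⬝ᵥ C *ᵥ x := by
  rw [vecMulVec_mul, trace_vecMulVec, dotProduct_comm, dotProduct_mulVec]

/-- The matrices whose column space is contained in the line spanned by `x`. -/
def colLine {k : Type*} (x : k → K) : Submodule K (Matrix k k K) :=
  LinearMap.range (vecMulVecBilin K K (m := k) (n := k) (A := K) x)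

theorem mem_colLine {k : Type*} {x : k → K} {A : Matrix k k K} :
    A ∈ colLine x ↔ ∃ φ, vecMulVec x φ = A := Iff.rfl

/-- The matrices that map `v` into the line spanned by `x`. -/
def intoLine {k : Type*} [Fintype k] (x v : k → K) : Submodule K (Matrix k k K) :=
  (Submodule.span K {x}).comap ((mulVecBilin K K).flip v)

theorem mem_intoLine {k : Type*} [Fintype k] {x v : k → K} {A : Matrix k k K} :
    A ∈ intoLine x v ↔ A *ᵥ v ∈ Submodule.span K {x} := Iff.rfl

theorem finrank_map_add_finrank_inf_ker {V W : Type*} [AddCommGroup V] [Module K V]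
    [FiniteDimensional K V] [AddCommGroup W] [Module K W] (D : Submodule K V) (f : V →ₗ[K] W) :
    finrank K (D.map f) + finrank K (D ⊓ LinearMap.ker f : Submodule K V) = finrank K D := by
  rw [← (f.domRestrict D).finrank_range_add_finrank_ker, LinearMap.range_domRestrict,
    LinearMap.ker_domRestrict, LinearEquiv.finrank_eq
      (D.equivSubtypeMap ((LinearMap.ker f).comap D.subtype)), Submodule.map_comap_subtype]

/-- If `X = Q⁻¹ * A * P` and its first column vanishes below the first entry, then `A` maps the
first column of `P` into the line spanned by the first column of `Q`. -/
theorem mem_intoLine_of_toBlocks₂₁_eq_zero {n : ℕ}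
    {P Q : Matrix (Fin (n + 1)) (Unit ⊕ Fin n) K} {Q' : Matrix (Unit ⊕ Fin n) (Fin (n + 1)) K}
    (hQ : Q * Q' = 1) {A : Matrix (Fin (n + 1)) (Fin (n + 1)) K}
    (h : (Q' * A * P).toBlocks₂₁ = 0) :
    A ∈ intoLine (Q *ᵥ Pi.single (Sum.inl ()) 1) (P *ᵥ Pi.single (Sum.inl ()) 1) := by
  rw [mem_intoLine, Submodule.mem_span_singleton]
  refine ⟨(Q' * A * P) (Sum.inl ()) (Sum.inl ()), ?_⟩
  have h₁ : (Q' * A * P) *ᵥ Pi.single (Sum.inl ()) 1 =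
      (Q' * A * P) (Sum.inl ()) (Sum.inl ()) • Pi.single (Sum.inl ()) 1 := by
    ext (i | i)
    · simp
    · have := congrFun (congrFun h i) ()
      simpa [toBlocks₂₁] using this
  rw [← mulVec_smul, ← h₁, mulVec_mulVec, mulVec_mulVec, ← Matrix.mul_assoc, ← Matrix.mul_assoc, hQ,
    Matrix.one_mul]

/-- If `X = Q⁻¹ * A * P` has only its first row nonzero, then all columns of `A` are multiples of
the first column of `Q`. -/
theorem eq_vecMulVec_of_toBlocks_eq_zero {n : ℕ}
    {P Q : Matrix (Fin (n + 1)) (Unit ⊕ Fin n) K} {P' Q' : Matrix (Unit ⊕ Fin n) (Fin (n + 1)) K}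
    (hP : P * P' = 1) (hQ : Q * Q' = 1) {A : Matrix (Fin (n + 1)) (Fin (n + 1)) K}
    (h₂₁ : (Q' * A * P).toBlocks₂₁ = 0) (h₂₂ : (Q' * A * P).toBlocks₂₂ = 0) :
    A = vecMulVec (Q *ᵥ Pi.single (Sum.inl ()) 1) ((Q' * A * P) (Sum.inl ()) ᵥ* P') := by
  have h₁ : Q' * A * P = vecMulVec (Pi.single (Sum.inl ()) 1) ((Q' * A * P) (Sum.inl ())) := by
    ext (i | i) (j | j)
    · simp [vecMulVec_apply]
    · simp [vecMulVec_apply]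
    · have := congrFun (congrFun h₂₁ i) j
      simpa [toBlocks₂₁, vecMulVec_apply] using this
    · have := congrFun (congrFun h₂₂ i) j
      simpa [toBlocks₂₂, vecMulVec_apply] using this
  rw [← vecMulVec_mul, ← mul_vecMulVec, ← h₁]
  calc A = (Q * Q') * A * (P * P') := by rw [hP, hQ, Matrix.one_mul, Matrix.mul_one]
    _ = _ := by simp only [Matrix.mul_assoc]

/-- The set of matrices `M` with `trace (A * M) = trace (A * C)` for all `A ∈ D` contains an
invertible matrix with `M *ᵥ x = v`, provided the first-column constraints are compatible and few
enough constraints remain on the complementary block. -/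
theorem exists_isUnit_of_finrank_inf_intoLine_lt {n : ℕ}
    (ih : ∀ (D : Submodule K (Matrix (Fin n) (Fin n) K)) (C : Matrix (Fin n) (Fin n) K),
      finrank K D < n → ∃ M, IsUnit M ∧ ∀ A ∈ D, trace (A * M) = trace (A * C))
    (D : Submodule K (Matrix (Fin (n + 1)) (Fin (n + 1)) K))
    (C : Matrix (Fin (n + 1)) (Fin (n + 1)) K) {x v : Fin (n + 1) → K} (hx : x ≠ 0) (hv : v ≠ 0)
    (h : ∀ φ, vecMulVec x φ ∈ D → φ ⬝ᵥ v = φ ⬝ᵥ C *ᵥ x)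
    (hD : finrank K (D ⊓ intoLine x v : Submodule K _) <
      n + finrank K (D ⊓ colLine x : Submodule K _)) :
    ∃ M, IsUnit M ∧ ∀ A ∈ D, trace (A * M) = trace (A * C) := by
  obtain ⟨Q, Q', hQ, hQ', rfl⟩ := exists_invertible_first_col hx
  obtain ⟨P, P', hP, hP', rfl⟩ := exists_invertible_first_col hv
  let p₁₁ : Matrix (Fin (n + 1)) (Fin (n + 1)) K →ₗ[K] K :=
    { toFun A := (Q' * A * P) (Sum.inl ()) (Sum.inl ())
      map_add' A B := by simp [Matrix.mul_add, Matrix.add_mul]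
      map_smul' c A := by simp }
  let p₂₁ : Matrix (Fin (n + 1)) (Fin (n + 1)) K →ₗ[K] Matrix (Fin n) Unit K :=
    { toFun A := (Q' * A * P).toBlocks₂₁
      map_add' A B := by ext; simp [Matrix.mul_add, Matrix.add_mul, toBlocks₂₁]
      map_smul' c A := by ext; simp [toBlocks₂₁] }
  let p₂₂ : Matrix (Fin (n + 1)) (Fin (n + 1)) K →ₗ[K] Matrix (Fin n) (Fin n) K :=
    { toFun A := (Q' * A * P).toBlocks₂₂
      map_add' A B := by ext; simp [Matrix.mul_add, Matrix.add_mul, toBlocks₂₂]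
      map_smul' c A := by ext; simp [toBlocks₂₂] }
  let τ : Matrix (Fin (n + 1)) (Fin (n + 1)) K →ₗ[K] K :=
    traceLinearMap _ K K ∘ₗ LinearMap.mulRight K C
  let D₀ := D ⊓ LinearMap.ker p₂₁
  have hker : ∀ A ∈ D₀, p₂₂ A = 0 → τ A - p₁₁ A = 0 := by
    intro A hA h₂₂
    have hA' := eq_vecMulVec_of_toBlocks_eq_zero hP hQ (A := A) hA.2 h₂₂
    have h₁ := h ((Q' * A * P) (Sum.inl ()) ᵥ* P') (hA' ▸ hA.1)
    rw [← dotProduct_mulVec, mulVec_mulVec, hP', one_mulVec, dotProduct_single_one] at h₁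
    rw [sub_eq_zero]
    change trace (A * C) = (Q' * A * P) (Sum.inl ()) (Sum.inl ())
    rw [h₁, ← trace_vecMulVec_mul, ← hA']
  obtain ⟨C', hC'⟩ := exists_trace_mul_eq (p₂₂.domRestrict D₀) ((τ - p₁₁).domRestrict D₀)
    fun A hA => hker A.1 A.2 hA
  have hcol : D ⊓ colLine (Q *ᵥ Pi.single (Sum.inl ()) 1) ≤ D₀ ⊓ LinearMap.ker p₂₂ := by
    rintro _ ⟨hA, φ, rfl⟩
    have h₁ : Q' * vecMulVec (Q *ᵥ Pi.single (Sum.inl ()) 1) φ * P =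
        vecMulVec (Pi.single (Sum.inl ()) 1) (φ ᵥ* P) := by
      rw [mul_vecMulVec, mulVec_mulVec, hQ', one_mulVec, vecMulVec_mul]
    refine ⟨⟨hA, ?_⟩, ?_⟩
    · change (Q' * vecMulVec (Q *ᵥ Pi.single (Sum.inl ()) 1) φ * P).toBlocks₂₁ = 0
      rw [h₁]
      ext
      simp [toBlocks₂₁, vecMulVec_apply]
    · change (Q' * vecMulVec (Q *ᵥ Pi.single (Sum.inl ()) 1) φ * P).toBlocks₂₂ = 0
      rw [h₁]
      ext
      simp [toBlocks₂₂, vecMulVec_apply]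
  have hinto : D₀ ≤ D ⊓ intoLine (Q *ᵥ Pi.single (Sum.inl ()) 1)
      (P *ᵥ Pi.single (Sum.inl ()) 1) :=
    fun A hA => ⟨hA.1, mem_intoLine_of_toBlocks₂₁_eq_zero hQ hA.2⟩
  have hlt : finrank K (D₀.map p₂₂) < n := by
    have h₁ := finrank_map_add_finrank_inf_ker D₀ p₂₂
    have h₂ := Submodule.finrank_mono hcol
    have h₃ := Submodule.finrank_mono hinto
    omega
  obtain ⟨N, hN, hN'⟩ := ih (D₀.map p₂₂) C' hlt
  let ν : Matrix (Fin n) (Fin n) K →ₗ[K] K := traceLinearMap _ K K ∘ₗ LinearMap.mulRight K N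
  obtain ⟨r, hr⟩ := exists_trace_mul_eq (p₂₁.domRestrict D)
      ((τ - p₁₁ - ν ∘ₗ p₂₂).domRestrict D) fun A hA => by
    have hA₀ : A.1 ∈ D₀ := ⟨A.2, hA⟩
    have h₁ := hN' _ (Submodule.mem_map_of_mem hA₀)
    have h₂ : trace (p₂₂ A.1 * C') = τ A.1 - p₁₁ A.1 := hC' ⟨A.1, hA₀⟩
    change τ A.1 - p₁₁ A.1 - trace (p₂₂ A.1 * N) = 0
    rw [h₁, h₂, sub_self]
  refine ⟨P * fromBlocks 1 r 0 N * Q', isUnit_mul_mul hP hQ' ?_, fun A hA => ?_⟩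
  · exact isUnit_fromBlocks_zero₂₁.2 ⟨isUnit_one, hN⟩
  · rw [trace_mul_conj, trace_mul_fromBlocks]
    have h₁ : trace ((Q' * A * P).toBlocks₂₁ * r) = trace (A * C) -
      (Q' * A * P) (Sum.inl ()) (Sum.inl ()) - trace ((Q' * A * P).toBlocks₂₂ * N) := hr ⟨A, hA⟩
    rw [h₁]
    simp [trace, toBlocks₁₁]

theorem vecMulVec_injective {k : Type*} {x : k → K} (hx : x ≠ 0) :
    Function.Injective (vecMulVecBilin K K (m := k) (n := k) (A := K) x) := by
  obtain ⟨i, hi⟩ := Function.ne_iff.1 hx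
  intro φ ψ h
  ext j
  exact mul_left_cancel₀ hi (congrFun (congrFun h i) j)

theorem finrank_colLine {n : ℕ} {x : Fin n → K} (hx : x ≠ 0) : finrank K (colLine x) = n := by
  rw [colLine, LinearMap.finrank_range_of_inj (vecMulVec_injective hx), finrank_fin_fun]

theorem mem_colLine_of_forall_mulVec {k : Type*} [Fintype k] {x : k → K} {A : Matrix k k K}
    (h : ∀ v, A *ᵥ v ∈ Submodule.span K {x}) : A ∈ colLine x := by
  classical
  choose c hc using fun j => Submodule.mem_span_singleton.1 (h (Pi.single j 1))
  refine mem_colLine.2 ⟨c, ?_⟩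
  ext i j
  have := congrFun (hc j) i
  simpa [vecMulVec_apply, mul_comm] using this

theorem exists_mulVec_ne_zero {k : Type*} [Fintype k] {A : Matrix k k K}
    (hA : A ≠ 0) : ∃ v, A *ᵥ v ≠ 0 := by
  classical
  by_contra! h
  exact hA (ext_of_mulVec_single fun i => by rw [h, zero_mulVec])

theorem exists_ne_zero_dotProduct_eq {k : Type*} [Fintype k] (F : Submodule K (k → K))
    (hF : F ≠ ⊤) : ∃ v ≠ 0, ∀ φ ∈ F, φ ⬝ᵥ v = 0 := by
  classical
  obtain ⟨f, hf, hFf⟩ := F.exists_le_ker_of_lt_top hF.lt_top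
  have hdot : ∀ φ, φ ⬝ᵥ (fun i => f (Pi.single i 1)) = f φ := fun φ => by
    rw [LinearMap.pi_apply_eq_sum_univ f φ]
    refine Finset.sum_congr rfl fun i _ => ?_
    have hs : (Pi.single i 1 : k → K) = fun j => if i = j then 1 else 0 :=
      funext fun j => by simp [Pi.single_apply, eq_comm]
    exact congrArg (fun z => φ i * f z) hs
  refine ⟨fun i => f (Pi.single i 1), fun h => hf ?_, fun φ hφ => ?_⟩
  · ext φ
    simpa using congrFun h φ
  · rw [hdot]
    exact hFf hφ

theorem exists_ne_zero_dotProduct_eq_of_not_le {k : Type*} [Fintype k]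
    {D : Submodule K (Matrix k k K)} {C : Matrix k k K} {x : k → K}
    (h : C *ᵥ x = 0 → ¬ colLine x ≤ D) :
    ∃ v ≠ 0, ∀ φ, vecMulVec x φ ∈ D → φ ⬝ᵥ v = φ ⬝ᵥ C *ᵥ x := by
  by_cases hC : C *ᵥ x = 0
  · obtain ⟨v, hv, hv'⟩ := exists_ne_zero_dotProduct_eq (D.comap (vecMulVecBilin K K x)) (by
      intro htop
      refine h hC ?_
      rintro _ ⟨φ, rfl⟩
      have : φ ∈ D.comap (vecMulVecBilin K K x) := htop ▸ Submodule.mem_top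
      exact this)
    exact ⟨v, hv, fun φ hφ => by rw [hC, dotProduct_zero]; exact hv' φ hφ⟩
  · exact ⟨_, hC, fun _ _ => rfl⟩

theorem eq_zero_of_vecMulVec_eq_zero {k : Type*} {x φ : k → K} (hx : x ≠ 0)
    (h : vecMulVec x φ = 0) : φ = 0 :=
  vecMulVec_injective hx (by simpa using h)

/-- Fewer than `n` affine trace conditions on `n × n` matrices have an invertible solution. -/
theorem exists_isUnit_of_finrank_lt (n : ℕ) (D : Submodule K (Matrix (Fin n) (Fin n) K))
    (C : Matrix (Fin n) (Fin n) K) (hD : finrank K D < n) :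
    ∃ M, IsUnit M ∧ ∀ A ∈ D, trace (A * M) = trace (A * C) := by
  induction n with
  | zero => omega
  | succ n ih =>
    by_cases hbot : D = ⊥
    · subst hbot
      refine ⟨1, isUnit_one, fun A hA => ?_⟩
      rw [(Submodule.mem_bot K).1 hA, Matrix.zero_mul, Matrix.zero_mul]
    by_cases hcol : ∃ x ≠ 0, D ⊓ colLine x ≠ ⊥
    · obtain ⟨x, hx, hDx⟩ := hcol
      obtain ⟨v, hv, hv'⟩ := exists_ne_zero_dotProduct_eq_of_not_le (D := D) (C := C) (x := x)
        fun _ hle => by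
          have := Submodule.finrank_mono hle
          rw [finrank_colLine hx] at this
          omega
      refine exists_isUnit_of_finrank_inf_intoLine_lt ih D C hx hv hv' ?_
      have h₁ := Submodule.one_le_finrank_iff.2 hDx
      have h₂ := Submodule.finrank_mono (inf_le_left : D ⊓ intoLine x v ≤ D)
      omega
    · push Not at hcol
      obtain ⟨A, hA, hA0⟩ := D.ne_bot_iff.1 hbot
      obtain ⟨v, hAv⟩ := exists_mulVec_ne_zero hA0
      have h₁ := Submodule.one_le_finrank_iff.2 hbot
      obtain ⟨x, hx⟩ : ∃ x, x ∉ Submodule.span K {A *ᵥ v} := by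
        by_contra! h
        have h₂ := finrank_span_singleton (K := K) hAv
        rw [(Submodule.eq_top_iff'.2 h), finrank_top, finrank_fin_fun] at h₂
        omega
      have hx0 : x ≠ 0 := fun h => hx (h ▸ Submodule.zero_mem _)
      have hv0 : v ≠ 0 := fun h => hAv (by rw [h, mulVec_zero])
      refine exists_isUnit_of_finrank_inf_intoLine_lt ih D C hx0 hv0 (fun φ hφ => ?_) ?_
      · have : vecMulVec x φ ∈ D ⊓ colLine x := ⟨hφ, φ, rfl⟩
        rw [hcol x hx0, Submodule.mem_bot] at this
        rw [eq_zero_of_vecMulVec_eq_zero hx0 this, zero_dotProduct, zero_dotProduct]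
      · have hlt : D ⊓ intoLine x v < D := by
          refine lt_of_le_of_ne inf_le_left fun h => ?_
          have hAx : A ∈ D ⊓ intoLine x v := h.symm ▸ hA
          obtain ⟨c, hc⟩ := Submodule.mem_span_singleton.1 (mem_intoLine.1 hAx.2)
          have hc0 : c ≠ 0 := fun h => hAv (by rw [← hc, h, zero_smul])
          exact hx (Submodule.mem_span_singleton.2 ⟨c⁻¹, by rw [← hc, inv_smul_smul₀ hc0]⟩)
        have := Submodule.finrank_lt_finrank_of_lt hlt
        omega

theorem exists_isUnit_fromBlocks_zero₁₁ {n : ℕ} {r : Matrix Unit (Fin n) K}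
    {c : Matrix (Fin n) Unit K} (hr : r ≠ 0) (hc : c ≠ 0) :
    ∃ N, IsUnit (fromBlocks 0 r c N) := by
  obtain ⟨w, hw⟩ : ∃ w, r () ⬝ᵥ w ≠ 0 := by
    by_contra! h
    exact hr (funext fun _ => dotProduct_eq_zero _ h)
  have hw0 : w ≠ 0 := fun h => hw (by rw [h, dotProduct_zero])
  have hc0 : (fun i => c i ()) ≠ 0 := fun h => hc (by ext i; exact congrFun h i)
  obtain ⟨G, hG, hGc⟩ := exists_isUnit_mulVec_eq hc0 hw0
  have hdet := (isUnit_iff_isUnit_det G).1 hG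
  let _ : Invertible G := hG.invertible
  refine ⟨⅟G, ?_⟩
  rw [isUnit_fromBlocks_iff_of_invertible₂₂, isUnit_iff_isUnit_det, det_unique]
  have : (r * G * c) () () = r () ⬝ᵥ w := by
    rw [← hGc, Matrix.mul_assoc]
    rfl
  simpa [this] using hw

theorem exists_ne_zero_ne_one (hK : 2 < Cardinal.mk K) : ∃ t : K, t ≠ 0 ∧ t ≠ 1 := by
  by_contra! h
  refine hK.ne' (Cardinal.mk_eq_two_iff.2 ⟨0, 1, zero_ne_one, Set.eq_univ_of_forall fun t => ?_⟩)
  by_cases ht : t = 0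
  · exact Or.inl ht
  · exact Or.inr (h t ht)

theorem exists_ne_zero_apply_ne {V : Type*} [AddCommGroup V] [Module K V] [FiniteDimensional K V]
    (hV : 1 < finrank K V ∨ 0 < finrank K V ∧ 2 < Cardinal.mk K) (f : V →ₗ[K] K) {t : K}
    (ht : t ≠ 0) : ∃ c ≠ 0, f c ≠ t := by
  by_contra! h
  rcases hV with hV | ⟨hV, hK⟩
  · have h₁ := LinearMap.finrank_range_add_finrank_ker f
    have h₂ := (LinearMap.range f).finrank_le
    rw [finrank_self] at h₂
    obtain ⟨c, hc, hc0⟩ := (LinearMap.ker f).ne_bot_iff.1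
      (Submodule.one_le_finrank_iff.1 (by omega))
    exact ht ((h c hc0).symm.trans hc)
  · obtain ⟨s, hs0, hs1⟩ := exists_ne_zero_ne_one hK
    have := finrank_pos_iff.1 hV
    obtain ⟨c, hc⟩ := exists_ne (0 : V)
    have h₁ := h (s • c) (smul_ne_zero hs0 hc)
    rw [map_smul, h c hc, smul_eq_mul] at h₁
    exact hs1 (mul_right_cancel₀ ht (h₁.trans (one_mul t).symm))

/-- The case where all matrices of `D` map the hyperplane `φ ⬝ᵥ v = 0` into the line spanned
by `x`. -/
theorem exists_isUnit_of_forall_mem_intoLine {n : ℕ}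
    (hn : 1 < n ∨ 0 < n ∧ 2 < Cardinal.mk K)
    {D : Submodule K (Matrix (Fin (n + 1)) (Fin (n + 1)) K)}
    {C : Matrix (Fin (n + 1)) (Fin (n + 1)) K} {x φ : Fin (n + 1) → K} (hx : x ≠ 0) (hφ : φ ≠ 0)
    (hinto : ∀ v, φ ⬝ᵥ v = 0 → ∀ B ∈ D, B ∈ intoLine x v)
    (hline : ∀ ψ, vecMulVec x ψ ∈ D → ∃ a : K, ψ = a • φ) (hCx : φ ⬝ᵥ C *ᵥ x = 0)
    (hC : ∃ A ∈ D, trace (A * C) ≠ 0) :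
    ∃ M, IsUnit M ∧ ∀ A ∈ D, trace (A * M) = trace (A * C) := by
  obtain ⟨Q, Q', hQ, hQ', rfl⟩ := exists_invertible_first_col hx
  obtain ⟨R, R', hR, hR', hRφ⟩ := exists_invertible_first_col hφ
  have hP : R'ᵀ * Rᵀ = 1 := by rw [← transpose_mul, hR, transpose_one]
  have hφP : φ ᵥ* R'ᵀ = Pi.single (Sum.inl ()) 1 := by
    rw [vecMul_transpose, ← hRφ, mulVec_mulVec, hR', one_mulVec]
  have hzero : ∀ B ∈ D, (Q' * B * R'ᵀ).toBlocks₂₂ = 0 := by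
    intro B hB
    ext i j
    have h₁ : φ ⬝ᵥ R'ᵀ *ᵥ Pi.single (Sum.inr j) 1 = 0 := by
      rw [dotProduct_mulVec, hφP]
      simp
    obtain ⟨c, hc⟩ := Submodule.mem_span_singleton.1 (mem_intoLine.1 (hinto _ h₁ B hB))
    have h₂ : (Q' * B * R'ᵀ) *ᵥ Pi.single (Sum.inr j) 1 = c • Pi.single (Sum.inl ()) 1 := by
      rw [← mulVec_mulVec, ← mulVec_mulVec, ← hc, mulVec_smul, mulVec_mulVec, hQ', one_mulVec]
    have h₃ := congrFun h₂ (Sum.inr i)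
    simpa [toBlocks₂₂] using h₃
  let p₁₂ : Matrix (Fin (n + 1)) (Fin (n + 1)) K →ₗ[K] Matrix Unit (Fin n) K :=
    { toFun A := (Q' * A * R'ᵀ).toBlocks₁₂
      map_add' A B := by ext; simp [Matrix.mul_add, Matrix.add_mul, toBlocks₁₂]
      map_smul' c A := by ext; simp [toBlocks₁₂] }
  let p₂₁ : Matrix (Fin (n + 1)) (Fin (n + 1)) K →ₗ[K] Matrix (Fin n) Unit K :=
    { toFun A := (Q' * A * R'ᵀ).toBlocks₂₁
      map_add' A B := by ext; simp [Matrix.mul_add, Matrix.add_mul, toBlocks₂₁]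
      map_smul' c A := by ext; simp [toBlocks₂₁] }
  let τ : Matrix (Fin (n + 1)) (Fin (n + 1)) K →ₗ[K] K :=
    traceLinearMap _ K K ∘ₗ LinearMap.mulRight K C
  obtain ⟨A, hA, hAC⟩ := hC
  obtain ⟨c, hc, hcA⟩ := exists_ne_zero_apply_ne (V := Matrix (Fin n) Unit K)
    (by rw [finrank_matrix]; simpa using hn)
    ({ toFun c := trace (p₁₂ A * c)
       map_add' c d := by simp [Matrix.mul_add]
       map_smul' a c := by simp } : Matrix (Fin n) Unit K →ₗ[K] K) hAC
  let σ : Matrix Unit (Fin n) K →ₗ[K] K :=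
    { toFun y := trace (y * c)
      map_add' y z := by simp [Matrix.add_mul]
      map_smul' a y := by simp }
  obtain ⟨r, hr⟩ := exists_trace_mul_eq (p₂₁.domRestrict D) ((τ - σ ∘ₗ p₁₂).domRestrict D)
    fun B hB => by
      have hB' := eq_vecMulVec_of_toBlocks_eq_zero hP hQ (A := B.1) hB (hzero B.1 B.2)
      obtain ⟨a, ha⟩ := hline _ (hB' ▸ B.2)
      rw [ha] at hB'
      have h₁ : τ B.1 = 0 := by
        change trace (B.1 * C) = 0
        rw [hB', trace_vecMulVec_mul, smul_dotProduct, hCx, smul_zero]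
      have h₂ : p₁₂ B.1 = 0 := by
        change (Q' * B.1 * R'ᵀ).toBlocks₁₂ = 0
        rw [hB', mul_vecMulVec, mulVec_mulVec, hQ', one_mulVec, vecMulVec_mul, smul_vecMul, hφP]
        ext
        simp [toBlocks₁₂, vecMulVec_apply]
      change τ B.1 - σ (p₁₂ B.1) = 0
      rw [h₁, h₂, map_zero, sub_zero]
  have hr' : ∀ B ∈ D, trace ((Q' * B * R'ᵀ).toBlocks₂₁ * r) =
    trace (B * C) - trace ((Q' * B * R'ᵀ).toBlocks₁₂ * c) := fun B hB => hr ⟨B, hB⟩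
  have hr0 : r ≠ 0 := by
    intro h
    have h₁ := hr' A hA
    rw [h, Matrix.mul_zero, trace_zero, eq_comm, sub_eq_zero] at h₁
    exact hcA h₁.symm
  obtain ⟨N, hN⟩ := exists_isUnit_fromBlocks_zero₁₁ hr0 hc
  refine ⟨R'ᵀ * fromBlocks 0 r c N * Q', isUnit_mul_mul hP hQ' hN, fun B hB => ?_⟩
  rw [trace_mul_conj, trace_mul_fromBlocks, hr' B hB, hzero B hB]
  simp

/-- If a space of matrices of dimension at least two contains no rank one matrix, then two of its
elements map some vector to linearly independent vectors. -/
theorem exists_linearIndependent_mulVec_pair {k : Type*} [Fintype k]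
    {D : Submodule K (Matrix k k K)} (hD : 1 < finrank K D)
    (hrank : ∀ x φ, vecMulVec x φ ∈ D → vecMulVec x φ = 0) :
    ∃ v, ∃ A ∈ D, ∃ B ∈ D, LinearIndependent K ![A *ᵥ v, B *ᵥ v] := by
  by_contra! hdep
  have hdep' : ∀ v, ∀ A ∈ D, ∀ B ∈ D, A *ᵥ v ≠ 0 → ∃ a : K, B *ᵥ v = a • A *ᵥ v := by
    intro v A hA B hB hAv
    have := hdep v A hA B hB
    rw [LinearIndependent.pair_iff' hAv] at this
    push Not at this
    obtain ⟨a, ha⟩ := this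
    exact ⟨a, ha.symm⟩
  obtain ⟨A, hA, hA0⟩ := D.ne_bot_iff.1 (Submodule.one_le_finrank_iff.1 hD.le)
  obtain ⟨v, hAv⟩ := exists_mulVec_ne_zero hA0
  obtain ⟨w, hw⟩ : ∃ w, A *ᵥ w ∉ Submodule.span K {A *ᵥ v} := by
    by_contra! h
    obtain ⟨φ, hφ⟩ := mem_colLine.1 (mem_colLine_of_forall_mulVec h)
    exact hA0 (hφ ▸ hrank _ φ (hφ.symm ▸ hA))
  have hind : ∀ a b : K, a • A *ᵥ v + b • A *ᵥ w = 0 → a = 0 ∧ b = 0 := by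
    rw [← LinearIndependent.pair_iff, LinearIndependent.pair_iff' hAv]
    exact fun a h => hw (Submodule.mem_span_singleton.2 ⟨a, h⟩)
  obtain ⟨B, hB, hBA⟩ : ∃ B ∈ D, B ∉ Submodule.span K {A} := by
    by_contra! h
    have h₁ := Submodule.finrank_mono (show D ≤ Submodule.span K {A} from h)
    rw [finrank_span_singleton hA0] at h₁
    omega
  obtain ⟨a, ha⟩ := hdep' v A hA B hB hAv
  obtain ⟨b, hb⟩ := hdep' w A hA B hB fun h => hw (h ▸ Submodule.zero_mem _)
  obtain ⟨c, hc⟩ := hdep' (v + w) A hA B hB fun h => by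
    rw [mulVec_add] at h
    exact one_ne_zero (hind 1 1 (by simpa using h)).1
  rw [mulVec_add, mulVec_add, ha, hb] at hc
  have hac := hind (a - c) (b - c) (by rw [← sub_eq_zero.2 hc]; module)
  have hab : b = a := by linear_combination hac.2 - hac.1
  subst hab
  have hC : B - b • A ∈ D := D.sub_mem hB (D.smul_mem _ hA)
  have hC0 : B - b • A ≠ 0 := fun h =>
    hBA (Submodule.mem_span_singleton.2 ⟨b, (sub_eq_zero.1 h).symm⟩)
  have hCv : (B - b • A) *ᵥ v = 0 := by rw [sub_mulVec, smul_mulVec, ha, sub_self]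
  have hCw : (B - b • A) *ᵥ w = 0 := by rw [sub_mulVec, smul_mulVec, hb, sub_self]
  generalize B - b • A = C at *
  obtain ⟨u, hu⟩ := exists_mulVec_ne_zero hC0
  obtain ⟨d, hd⟩ := hdep' u C hC A hA hu
  obtain ⟨e, he⟩ := hdep' (u + v) C hC A hA (by rwa [mulVec_add, hCv, add_zero])
  obtain ⟨f, hf⟩ := hdep' (u + w) C hC A hA (by rwa [mulVec_add, hCw, add_zero])
  rw [mulVec_add, mulVec_add, hCv, add_zero, hd] at he
  rw [mulVec_add, mulVec_add, hCw, add_zero, hd] at hf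
  have hv' : A *ᵥ v = (e - d) • C *ᵥ u := by rw [sub_smul, ← he, add_sub_cancel_left]
  have hw' : A *ᵥ w = (f - d) • C *ᵥ u := by rw [sub_smul, ← hf, add_sub_cancel_left]
  have := hind (f - d) (-(e - d)) (by rw [hv', hw']; module)
  rw [neg_eq_zero] at this
  exact hAv (by rw [hv', this.2, zero_smul])

theorem exists_eq_vecMulVec_of_det_eq_zero {N : Matrix (Fin 2) (Fin 2) K} (hN : N.det = 0) :
    ∃ w s, N = vecMulVec w s := by
  rw [det_fin_two] at hN
  by_cases h₀ : N 0 0 = 0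
  · by_cases h₁ : N 0 1 = 0
    · refine ⟨![0, 1], N 1, ?_⟩
      ext i j
      fin_cases i <;> fin_cases j <;> simp [vecMulVec_apply, h₀, h₁]
    · refine ⟨![1, N 1 1 / N 0 1], N 0, ?_⟩
      ext i j
      fin_cases i <;> fin_cases j <;> simp [vecMulVec_apply] <;> field_simp
      linear_combination -hN
  · refine ⟨![1, N 1 0 / N 0 0], N 0, ?_⟩
    ext i j
    fin_cases i <;> fin_cases j <;> simp [vecMulVec_apply] <;> field_simp
    linear_combination hN

/-- The case of a plane of `2 × 2` matrices without rank one elements. -/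
theorem exists_isUnit_fin_two (hK : 2 < Cardinal.mk K)
    {D : Submodule K (Matrix (Fin 2) (Fin 2) K)} (hD : finrank K D = 2)
    (hrank : ∀ x φ, vecMulVec x φ ∈ D → vecMulVec x φ = 0) (C : Matrix (Fin 2) (Fin 2) K) :
    ∃ M, IsUnit M ∧ ∀ A ∈ D, trace (A * M) = trace (A * C) := by
  have htop : D ≠ ⊤ := by
    intro h
    rw [h, finrank_top, finrank_matrix] at hD
    simp at hD
  obtain ⟨f, hf, hDf⟩ := D.exists_le_ker_of_lt_top htop.lt_top
  obtain ⟨N, hN⟩ := exists_trace_mul_eq LinearMap.id f (by simp)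
  have hND : ∀ A ∈ D, trace (A * N) = 0 := fun A hA => (hN A).trans (hDf hA)
  have hN0 : N ≠ 0 := by
    rintro rfl
    exact hf (LinearMap.ext fun A => by rw [← hN A]; simp)
  have hNdet : N.det ≠ 0 := by
    intro h
    obtain ⟨w, s, rfl⟩ := exists_eq_vecMulVec_of_det_eq_zero h
    have hw : w ≠ 0 := by rintro rfl; exact hN0 (by simp)
    have hs : s ≠ 0 := by rintro rfl; exact hN0 (by simp)
    let ev : D →ₗ[K] Fin 2 → K := ((mulVecBilin K K).flip w).domRestrict D
    have hinj : Function.Injective ev := by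
      rw [← LinearMap.ker_eq_bot, LinearMap.ker_eq_bot']
      intro A hA
      obtain ⟨x, φ, hxφ⟩ := exists_eq_vecMulVec_of_det_eq_zero
        (exists_mulVec_eq_zero_iff.1 ⟨w, hw, hA⟩)
      exact Subtype.ext (hxφ.trans (hrank x φ (hxφ ▸ A.2)))
    have hsurj := (LinearMap.injective_iff_surjective_of_finrank_eq_finrank
      (by rw [hD, finrank_fin_fun])).1 hinj
    refine hs (dotProduct_eq_zero _ fun y => ?_)
    obtain ⟨A, rfl⟩ := hsurj y
    have := hND A.1 A.2
    rwa [trace_mul_comm, trace_vecMulVec_mul] at this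
  by_contra! hsing
  have hdet : ∀ t : K, (C + t • N).det = 0 := by
    intro t
    by_contra h
    obtain ⟨A, hA, hA'⟩ := hsing (C + t • N)
      ((isUnit_iff_isUnit_det _).2 (isUnit_iff_ne_zero.2 h))
    refine hA' ?_
    rw [Matrix.mul_add, trace_add, Matrix.mul_smul, trace_smul, hND A hA, smul_zero, add_zero]
  obtain ⟨t, ht0, ht1⟩ := exists_ne_zero_ne_one hK
  have h₀ := hdet 0
  have h₁ := hdet 1
  have h₂ := hdet t
  simp only [det_fin_two, add_apply, smul_apply, smul_eq_mul] at h₀ h₁ h₂ hNdet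
  have : t * (t - 1) * (N 0 0 * N 1 1 - N 0 1 * N 1 0) = 0 := by
    linear_combination h₂ - t * h₁ + (t - 1) * h₀
  simp [ht0, sub_eq_zero, ht1] at this
  exact hNdet (by linear_combination this)

/-- If a space of matrices of dimension `n + 1 ≥ 2` contains no rank one matrix and `n ≥ 2` or
`K` has more than two elements, every system of trace conditions has an invertible solution. -/
theorem exists_isUnit_of_forall_vecMulVec_eq_zero {n : ℕ}
    (hn : 1 < n ∨ 0 < n ∧ 2 < Cardinal.mk K)
    {D : Submodule K (Matrix (Fin (n + 1)) (Fin (n + 1)) K)} (hD : finrank K D = n + 1)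
    (hrank : ∀ x φ, vecMulVec x φ ∈ D → vecMulVec x φ = 0)
    (C : Matrix (Fin (n + 1)) (Fin (n + 1)) K) :
    ∃ M, IsUnit M ∧ ∀ A ∈ D, trace (A * M) = trace (A * C) := by
  by_cases hn1 : n = 1
  · subst hn1
    exact exists_isUnit_fin_two (hn.resolve_left (lt_irrefl 1)).2 hD hrank C
  obtain ⟨v, A, hA, B, hB, hAB⟩ := exists_linearIndependent_mulVec_pair (by omega) hrank
  have hind := LinearIndependent.pair_iff.1 hAB
  obtain ⟨x, hx⟩ : ∃ x, x ∉ Submodule.span K (Set.range ![A *ᵥ v, B *ᵥ v]) := by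
    by_contra! h
    have h₁ := finrank_span_eq_card hAB
    rw [Submodule.eq_top_iff'.2 h, finrank_top, finrank_fin_fun, Fintype.card_fin] at h₁
    omega
  have hx0 : x ≠ 0 := fun h => hx (h ▸ Submodule.zero_mem _)
  have hv0 : v ≠ 0 := fun h => hAB.ne_zero 0 (by simp [h])
  have hmem : ∀ a b : K, a • A + b • B ∈ intoLine x v → a = 0 ∧ b = 0 := by
    intro a b h
    obtain ⟨c, hc⟩ := Submodule.mem_span_singleton.1 (mem_intoLine.1 h)
    rw [add_mulVec, smul_mulVec, smul_mulVec] at hc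
    by_cases hc0 : c = 0
    · exact hind a b (by rw [← hc, hc0, zero_smul])
    · refine absurd ?_ hx
      have hsp : c • x ∈ Submodule.span K (Set.range ![A *ᵥ v, B *ᵥ v]) := by
        rw [hc]
        exact Submodule.add_mem _
          (Submodule.smul_mem _ _ (Submodule.subset_span ⟨0, rfl⟩))
          (Submodule.smul_mem _ _ (Submodule.subset_span ⟨1, rfl⟩))
      exact (Submodule.smul_mem_iff _ hc0).1 hsp
  refine exists_isUnit_of_finrank_inf_intoLine_lt (exists_isUnit_of_finrank_lt n) D C hx0 hv0
    (fun φ hφ => ?_) ?_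
  · rw [eq_zero_of_vecMulVec_eq_zero hx0 (hrank x φ hφ), zero_dotProduct, zero_dotProduct]
  · have hlt₁ : D ⊓ intoLine x v < (D ⊓ intoLine x v) ⊔ Submodule.span K {A} := by
      rw [left_lt_sup, Submodule.span_singleton_le_iff_mem]
      exact fun h => one_ne_zero (hmem 1 0 (by simpa using h.2)).1
    have hlt₂ : (D ⊓ intoLine x v) ⊔ Submodule.span K {A} < D := by
      refine lt_of_le_of_ne
        (sup_le inf_le_left ((Submodule.span_singleton_le_iff_mem _ _).2 hA)) fun h => ?_
      obtain ⟨S, hS, T, hT, hST⟩ := Submodule.mem_sup.1 (h.symm ▸ hB :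
        B ∈ (D ⊓ intoLine x v) ⊔ Submodule.span K {A})
      obtain ⟨a, rfl⟩ := Submodule.mem_span_singleton.1 hT
      refine one_ne_zero (hmem (-a) 1 ?_).2
      rw [one_smul, ← hST, show -a • A + (S + a • A) = S by module]
      exact hS.2
    have h₁ := Submodule.finrank_lt_finrank_of_lt hlt₁
    have h₂ := Submodule.finrank_lt_finrank_of_lt hlt₂
    omega

/-- If `n > 2` or `K` has more than two elements, then `n` trace conditions on `n × n` matrices
that are not all homogeneous have an invertible solution. -/
theorem exists_isUnit_of_finrank_le {n : ℕ} (h : 2 < n ∨ 2 < Cardinal.mk K)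
    {D : Submodule K (Matrix (Fin n) (Fin n) K)} {C : Matrix (Fin n) (Fin n) K}
    (hD : finrank K D ≤ n) (hC : ∃ A ∈ D, trace (A * C) ≠ 0) :
    ∃ M, IsUnit M ∧ ∀ A ∈ D, trace (A * M) = trace (A * C) := by
  rcases lt_or_eq_of_le hD with hlt | hD
  · exact exists_isUnit_of_finrank_lt n D C hlt
  rcases n with _ | n
  · obtain ⟨A, -, hA⟩ := hC
    exact absurd (by simp [trace]) hA
  rcases Nat.eq_zero_or_pos n with rfl | hn0
  · refine ⟨C, ?_, fun _ _ => rfl⟩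
    obtain ⟨A, -, hA⟩ := hC
    rw [isUnit_iff_isUnit_det, det_fin_one, isUnit_iff_ne_zero]
    intro h0
    exact hA (by simp [trace, mul_apply, h0])
  have hn : 1 < n ∨ 0 < n ∧ 2 < Cardinal.mk K := h.imp (by omega) fun h => ⟨hn0, h⟩
  by_cases hrank : ∀ x φ, vecMulVec x φ ∈ D → vecMulVec x φ = 0
  · exact exists_isUnit_of_forall_vecMulVec_eq_zero hn hD hrank C
  push Not at hrank
  obtain ⟨x, φ, hxφ, hxφ0⟩ := hrank
  have hx : x ≠ 0 := by rintro rfl; exact hxφ0 (by simp)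
  have hφ : φ ≠ 0 := by rintro rfl; exact hxφ0 (by simp)
  have hmem : vecMulVec x φ ∈ D ⊓ colLine x := ⟨hxφ, φ, rfl⟩
  have hpos := Submodule.one_le_finrank_iff.2 ((Submodule.ne_bot_iff _).2 ⟨_, hmem, hxφ0⟩)
  rcases hpos.lt_or_eq with htwo | hone
  · obtain ⟨v, hv, hv'⟩ := exists_ne_zero_dotProduct_eq_of_not_le (D := D) (C := C) (x := x)
      fun hCx hle => by
        obtain ⟨A, hA, hAC⟩ := hC
        rw [← Submodule.eq_of_le_of_finrank_eq hle (by rw [finrank_colLine hx, hD])] at hA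
        obtain ⟨ψ, rfl⟩ := mem_colLine.1 hA
        exact hAC (by rw [trace_vecMulVec_mul, hCx, dotProduct_zero])
    refine exists_isUnit_of_finrank_inf_intoLine_lt (exists_isUnit_of_finrank_lt n) D C hx hv hv' ?_
    have := Submodule.finrank_mono (inf_le_left : D ⊓ intoLine x v ≤ D)
    omega
  have hline : ∀ ψ, vecMulVec x ψ ∈ D → ∃ a : K, ψ = a • φ := by
    intro ψ hψ
    obtain ⟨a, ha⟩ := (finrank_eq_one_iff_of_nonzero' (⟨_, hmem⟩ : (D ⊓ colLine x :
      Submodule K _)) (fun h => hxφ0 (congrArg Subtype.val h))).1 hone.symm ⟨_, hψ, ψ, rfl⟩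
    refine ⟨a, vecMulVec_injective hx ?_⟩
    rw [map_smul]
    exact (congrArg Subtype.val ha).symm
  by_cases hB : ∃ v ≠ 0, φ ⬝ᵥ v = φ ⬝ᵥ C *ᵥ x ∧ ∃ B ∈ D, B ∉ intoLine x v
  · obtain ⟨v, hv, hφv, B, hB, hBv⟩ := hB
    refine exists_isUnit_of_finrank_inf_intoLine_lt (exists_isUnit_of_finrank_lt n) D C hx hv
      (fun ψ hψ => ?_) ?_
    · obtain ⟨a, rfl⟩ := hline ψ hψ
      rw [smul_dotProduct, smul_dotProduct, hφv]
    · have hlt : D ⊓ intoLine x v < D :=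
        lt_of_le_of_ne inf_le_left fun h => hBv (h.symm ▸ hB : B ∈ D ⊓ intoLine x v).2
      have := Submodule.finrank_lt_finrank_of_lt hlt
      omega
  push Not at hB
  by_cases hCx : φ ⬝ᵥ C *ᵥ x = 0
  · refine exists_isUnit_of_forall_mem_intoLine hn hx hφ (fun v hv B hBD => ?_) hline hCx hC
    by_cases hv0 : v = 0
    · rw [mem_intoLine, hv0, mulVec_zero]
      exact Submodule.zero_mem _
    · exact hB v hv0 (hv.trans hCx.symm) B hBD
  · exfalso
    have hne : ∀ v, φ ⬝ᵥ v = φ ⬝ᵥ C *ᵥ x → v ≠ 0 := by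
      rintro _ h₀ rfl
      exact hCx (by rw [← h₀, dotProduct_zero])
    have hle : D ≤ colLine x := by
      intro B hBD
      refine mem_colLine_of_forall_mulVec fun w => ?_
      by_cases hw : φ ⬝ᵥ w = 0
      · have h₁ : φ ⬝ᵥ (w + C *ᵥ x) = φ ⬝ᵥ C *ᵥ x := by rw [dotProduct_add, hw, zero_add]
        have h₂ := hB _ (hne _ h₁) h₁ B hBD
        have h₃ := hB _ (hne _ rfl) rfl B hBD
        rw [mem_intoLine] at h₂ h₃
        rw [mulVec_add] at h₂
        exact (Submodule.add_mem_iff_left _ h₃).1 h₂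
      · have h₁ : φ ⬝ᵥ (((φ ⬝ᵥ C *ᵥ x) / (φ ⬝ᵥ w)) • w) = φ ⬝ᵥ C *ᵥ x := by
          rw [dotProduct_smul, smul_eq_mul, div_mul_cancel₀ _ hw]
        have h₂ := hB _ (hne _ h₁) h₁ B hBD
        rw [mem_intoLine, mulVec_smul] at h₂
        exact (Submodule.smul_mem_iff _ (div_ne_zero hCx hw)).1 h₂
    rw [inf_eq_left.2 hle] at hone
    omega

end Matrix

end

/-- If `n > 2` or `|K| > 2`, every affine automorphism of `Matₙ(K)` mapping
invertible matrices to invertible matrices is linear, i.e. sends `0` to `0`. -/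
theorem stmt_8 (n : ℕ) (K : Type*) [Field K] (h : 2 < n ∨ 2 < Cardinal.mk K)
    (u : Matrix (Fin n) (Fin n) K ≃ᵃ[K] Matrix (Fin n) (Fin n) K)
    (hu : ∀ M : Matrix (Fin n) (Fin n) K, IsUnit M → IsUnit (u M)) :
    u 0 = 0 := by
  by_contra h0
  obtain ⟨y, hy⟩ := Matrix.exists_mulVec_ne_zero h0
  have hy0 : y ≠ 0 := by rintro rfl; exact hy (Matrix.mulVec_zero _)
  have hsub : ∀ M, u M = u.linear M + u 0 := fun M => by
    have := u.map_vadd 0 M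
    simpa using this
  have hrep : ∀ i, ∃ A : Matrix (Fin n) (Fin n) K,
      ∀ M, Matrix.trace (A * M) = Matrix.mulVec (u.linear M) y i := fun i => by
    obtain ⟨A, hA⟩ := Matrix.exists_trace_mul_eq LinearMap.id
      (LinearMap.proj i ∘ₗ (Matrix.mulVecBilin K K).flip y ∘ₗ u.linear.toLinearMap) (by simp)
    exact ⟨A, fun M => (Matrix.trace_mul_comm _ _).trans (hA M)⟩
  choose A hA using hrep
  have hC := hsub (u.symm 0)
  rw [u.apply_symm_apply, eq_comm, add_eq_zero_iff_eq_neg] at hC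
  obtain ⟨i, hi⟩ := Function.ne_iff.1 hy
  obtain ⟨M, hM, hM'⟩ := Matrix.exists_isUnit_of_finrank_le h
    (D := Submodule.span K (Set.range A)) (C := u.symm 0)
    ((finrank_range_le_card A).trans_eq (Fintype.card_fin n))
    ⟨A i, Submodule.subset_span ⟨i, rfl⟩, by
      rw [hA, hC, Matrix.neg_mulVec, Pi.neg_apply]
      exact neg_ne_zero.2 hi⟩
  have hMy : Matrix.mulVec (u M) y = 0 := by
    have h₁ : Matrix.mulVec (u.linear M) y = Matrix.mulVec (u.linear (u.symm 0)) y := by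
      ext j
      rw [← hA, ← hA, hM' _ (Submodule.subset_span ⟨j, rfl⟩)]
    rw [hsub, Matrix.add_mulVec, h₁, hC, Matrix.neg_mulVec, neg_add_cancel]
  exact (Matrix.isUnit_iff_isUnit_det _).1 (hu M hM) |>.ne_zero
    (Matrix.exists_mulVec_eq_zero_iff.1 ⟨y, hy0, hMy⟩)
end

section
/- Let K be a field with n > 2 or |K| > 2, and let u be an affine automorphism of Matₙ(K) stabilizing GLₙ(K). Then u is of the form M ↦ P M Q or M ↦ P Mᵗ Q for some fixed P, Q ∈ GLₙ(K). -/
open Matrix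

namespace AffinePreserver

variable {ι K : Type*} [Field K]

/-- A matrix of rank at most one, presented as a product of a column and a row. -/
def IsDyad (M : Matrix ι ι K) : Prop := ∃ a b, M = vecMulVec a b

/-- The second difference of the determinant in the directions `M` and `N` vanishes. -/
def DetOrthogonal [Fintype ι] [DecidableEq ι] (M N : Matrix ι ι K) : Prop :=
  ∀ A : Matrix ι ι K, (A + M + N).det - (A + M).det - (A + N).det + A.det = 0

theorem exists_det_add_vecMulVec [Fintype ι] [DecidableEq ι] (A : Matrix ι ι K) (a : ι → K) :
    ∃ φ : (ι → K) →ₗ[K] K, ∀ b, (A + vecMulVec a b).det = A.det + φ b := by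
  by_cases ha : a = 0
  · exact ⟨0, by simp [ha]⟩
  obtain ⟨k, hk⟩ := Function.ne_iff.mp ha
  have hk : a k ≠ 0 := hk
  let c : ι → K := fun i => if i = k then 0 else a i / a k
  let C : Matrix ι ι K := fun i j => A i j - c i * A k j
  have key : ∀ b, (A + vecMulVec a b).det = (C.updateRow k (A k + a k • b)).det := by
    intro b
    refine det_eq_of_forall_row_eq_smul_add_const c k (by simp [c]) fun i j => ?_
    by_cases hik : i = k
    · subst hik
      simp [c, vecMulVec_apply]
    · rw [updateRow_ne hik, updateRow_self]
      simp only [c, C, if_neg hik, Matrix.add_apply, vecMulVec_apply, Pi.add_apply, Pi.smul_apply,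
        smul_eq_mul]
      field_simp
      ring
  refine ⟨a k • (detRowAlternating (n := ι) (R := K)).toMultilinearMap.toLinearMap C k,
    fun b => ?_⟩
  have h0 := key 0
  simp only [vecMulVec_zero, add_zero, smul_zero] at h0
  rw [key b, det_updateRow_add, ← h0, det_updateRow_smul]
  rfl

theorem exists_isUnit_mul_diagonal_mul [Fintype ι] [DecidableEq ι] (M : Matrix ι ι K) :
    ∃ (P Q : Matrix ι ι K) (D : ι → K), IsUnit P ∧ IsUnit Q ∧ M = P * diagonal D * Q := by
  obtain ⟨L, L', D, h⟩ := Pivot.exists_list_transvec_mul_diagonal_mul_list_transvec M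
  refine ⟨_, _, D, ?_, ?_, h⟩ <;>
    simp [isUnit_iff_isUnit_det, TransvectionStruct.det_toMatrix_prod]

theorem isDyad_or_exists_diagonal [Fintype ι] [DecidableEq ι] (M : Matrix ι ι K) :
    IsDyad M ∨ ∃ (P Q : Matrix ι ι K) (D : ι → K) (p q : ι), IsUnit P ∧ IsUnit Q ∧ p ≠ q ∧
      D p ≠ 0 ∧ D q ≠ 0 ∧ M = P * diagonal D * Q := by
  obtain ⟨P, Q, D, hP, hQ, rfl⟩ := exists_isUnit_mul_diagonal_mul M
  by_cases h : ∃ p q, p ≠ q ∧ D p ≠ 0 ∧ D q ≠ 0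
  · obtain ⟨p, q, hpq, hp, hq⟩ := h
    exact .inr ⟨P, Q, D, p, q, hP, hQ, hpq, hp, hq, rfl⟩
  left
  push Not at h
  by_cases hD : ∃ p, D p ≠ 0
  · obtain ⟨p, hp⟩ := hD
    have : diagonal D = vecMulVec (Pi.single p (D p)) (Pi.single p 1) := by
      ext i j
      rw [vecMulVec_apply, diagonal_apply]
      by_cases hi : i = p
      · subst hi
        simp [Pi.single_apply, eq_comm]
      · simp [Pi.single_apply, hi, h p i (Ne.symm hi) hp]
    exact ⟨P *ᵥ Pi.single p (D p), Pi.single p 1 ᵥ* Q, by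
      rw [this, mul_vecMulVec, vecMulVec_mul]⟩
  · push Not at hD
    have : D = 0 := funext hD
    exact ⟨0, 0, by simp [this]⟩

theorem IsDyad.det_add_smul_eq_zero [Fintype ι] [DecidableEq ι] {N : Matrix ι ι K} (hN : IsDyad N)
    {A : Matrix ι ι K}
    (h0 : A.det = 0) (h1 : (A + N).det = 0) (t : K) : (A + t • N).det = 0 := by
  obtain ⟨a, b, rfl⟩ := hN
  obtain ⟨φ, hφ⟩ := exists_det_add_vecMulVec A a
  rw [hφ, h0, zero_add] at h1
  rw [← vecMulVec_smul, hφ, h0, map_smul, h1]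
  simp

theorem isDyad_of_det_add_smul_eq_zero [Fintype ι] [DecidableEq ι] {N : Matrix ι ι K} {t : K}
    (ht0 : t ≠ 0) (ht1 : t ≠ 1)
    (h : ∀ A : Matrix ι ι K, A.det = 0 → (A + N).det = 0 → (A + t • N).det = 0) :
    IsDyad N := by
  refine (isDyad_or_exists_diagonal N).resolve_right ?_
  rintro ⟨P, Q, D, p, q, hP, hQ, hpq, hp, hq, rfl⟩
  rw [isUnit_iff_isUnit_det, isUnit_iff_ne_zero] at hP hQ
  classical
  let E : ι → K := fun k => if k = p then 0 else if D k = 0 then 1 else -D k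
  have key : ∀ s : K, (P * diagonal E * Q + s • (P * diagonal D * Q)).det
      = P.det * (∏ k, (E k + s * D k)) * Q.det := by
    intro s
    rw [← smul_mul, ← Matrix.mul_smul, ← add_mul, ← mul_add, ← diagonal_smul, diagonal_add,
      det_mul, det_mul, det_diagonal]
    simp
  have h0 := key 0
  have h1 := key 1
  simp only [zero_smul, add_zero, one_smul, one_mul, zero_mul] at h0 h1
  rw [Finset.prod_eq_zero (Finset.mem_univ p) (by simp [E]), mul_zero, zero_mul] at h0
  rw [Finset.prod_eq_zero (Finset.mem_univ q) (by simp [E, hpq.symm, hq]), mul_zero, zero_mul] at h1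
  have h2 := h _ h0 h1
  rw [key t] at h2
  have h3 : ∏ k, (E k + t * D k) ≠ 0 := by
    refine Finset.prod_ne_zero_iff.mpr fun k _ => ?_
    by_cases hkp : k = p
    · simp [E, hkp, ht0, hp]
    by_cases hk : D k = 0
    · simp [E, hkp, hk]
    · have : E k + t * D k = (t - 1) * D k := by simp [E, hkp, hk]; ring
      rw [this]
      exact mul_ne_zero (sub_ne_zero.mpr ht1) hk
  exact mul_ne_zero (mul_ne_zero hP h3) hQ h2

theorem detOrthogonal_vecMulVec [Fintype ι] [DecidableEq ι] (a b c : ι → K) :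
    DetOrthogonal (vecMulVec a b) (vecMulVec a c) := by
  intro A
  obtain ⟨φ, hφ⟩ := exists_det_add_vecMulVec A a
  rw [add_assoc, ← vecMulVec_add, hφ, hφ, hφ, map_add]
  ring

theorem DetOrthogonal.of_mul_mul [Fintype ι] [DecidableEq ι] {P Q M N : Matrix ι ι K}
    (hP : IsUnit P) (hQ : IsUnit Q)
    (h : DetOrthogonal (P * M * Q) (P * N * Q)) : DetOrthogonal M N := by
  intro A
  rw [isUnit_iff_isUnit_det, isUnit_iff_ne_zero] at hP hQ
  have := h (P * A * Q)
  simp only [← add_mul, ← mul_add, det_mul] at this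
  refine (mul_eq_zero_iff_left (mul_ne_zero hP hQ)).mp ?_
  linear_combination this

theorem det_add_single_succAbove {n : ℕ} (X : Matrix (Fin (n + 1)) (Fin (n + 1)) K)
    (r c : Fin (n + 1)) :
    (X + single r c 1).det
      = X.det + (-1) ^ (r + c : ℕ) * (X.submatrix r.succAbove c.succAbove).det := by
  have : X + single r c 1 = X.updateRow r (X r + Pi.single c 1) := by
    ext i j
    by_cases hi : i = r
    · subst hi
      simp [single_apply, Pi.single_apply, eq_comm]
    · simp [updateRow_ne hi, Ne.symm hi]
  rw [this, det_updateRow_add, updateRow_eq_self, ← adjugate_apply,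
    adjugate_fin_succ_eq_det_submatrix]

theorem DetOrthogonal.submatrix {n : ℕ} {M N : Matrix (Fin (n + 1)) (Fin (n + 1)) K}
    (h : DetOrthogonal M N) (r c : Fin (n + 1)) :
    DetOrthogonal (M.submatrix r.succAbove c.succAbove) (N.submatrix r.succAbove c.succAbove) := by
  intro A
  let B : Matrix (Fin (n + 1)) (Fin (n + 1)) K :=
    fun i j => r.insertNth (α := fun _ => K) 0
      (fun i' => c.insertNth (α := fun _ => K) 0 (A i') j) i
  have hB : B.submatrix r.succAbove c.succAbove = A := by
    ext i j
    change B (r.succAbove i) (c.succAbove j) = A i j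
    simp [B]
  have h1 := h B
  have h2 := h (B + single r c 1)
  have e : ∀ X, B + single r c 1 + X = B + X + single r c 1 := fun X => add_right_comm _ _ _
  rw [e, add_right_comm (B + M), e, det_add_single_succAbove, det_add_single_succAbove,
    det_add_single_succAbove, det_add_single_succAbove] at h2
  simp only [submatrix_add, Pi.add_apply, hB] at h2
  refine (mul_eq_zero_iff_left (pow_ne_zero (r + c : ℕ) (neg_ne_zero.mpr one_ne_zero))).mp ?_
  linear_combination h2 - h1

theorem DetOrthogonal.minor_eq_zero : ∀ {n : ℕ} {M N : Matrix (Fin n) (Fin n) K},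
    DetOrthogonal M N → ∀ {i k j l : Fin n}, i ≠ k → j ≠ l →
      M i j * N k l + M k l * N i j - M i l * N k j - M k j * N i l = 0
  | 0, _, _, _, i, _, _, _, _, _ => i.elim0
  | 1, _, _, _, i, k, _, _, hik, _ => absurd (Subsingleton.elim i k) hik
  | 2, M, N, h, i, k, j, l, hik, hjl => by
    have := h 0
    simp only [det_fin_two, zero_add, Matrix.add_apply, Matrix.zero_apply] at this
    fin_cases i <;> fin_cases k <;> fin_cases j <;> fin_cases l <;> simp at hik hjl ⊢ <;>
      first
      | linear_combination this
      | linear_combination -this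
  | n + 3, M, N, h, i, k, j, l, hik, hjl => by
    have avoid : ∀ x y : Fin (n + 3), ∃ z, x ≠ z ∧ y ≠ z := by
      intro x y
      have : ({x, y} : Finset (Fin (n + 3))).card < Fintype.card (Fin (n + 3)) :=
        (Finset.card_le_two).trans_lt (by simp)
      obtain ⟨z, hz⟩ := Finset.exists_mem_notMem_of_card_lt_card
        (this.trans_eq Finset.card_univ.symm)
      exact ⟨z, by rintro rfl; simp at hz, by rintro rfl; simp at hz⟩
    obtain ⟨r, hir, hkr⟩ := avoid i k
    obtain ⟨c, hjc, hlc⟩ := avoid j l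
    obtain ⟨i, rfl⟩ := Fin.exists_succAbove_eq hir
    obtain ⟨k, rfl⟩ := Fin.exists_succAbove_eq hkr
    obtain ⟨j, rfl⟩ := Fin.exists_succAbove_eq hjc
    obtain ⟨l, rfl⟩ := Fin.exists_succAbove_eq hlc
    exact (h.submatrix r c).minor_eq_zero (fun e => hik (e ▸ rfl)) (fun e => hjl (e ▸ rfl))

theorem eq_smul_diagonal_of_minor_eq_zero [DecidableEq ι] {M : Matrix ι ι K} {D : ι → K} {p q : ι}
    (h2 : (2 : K) = 0) (hpq : p ≠ q) (hp : D p ≠ 0) (hq : D q ≠ 0)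
    (h : ∀ i k j l, i ≠ k → j ≠ l → diagonal D i j * M k l + diagonal D k l * M i j
      - diagonal D i l * M k j - diagonal D k j * M i l = 0)
    (h_pq : M p q = 0) (h_qp : M q p = 0) : M = (M p p / D p) • diagonal D := by
  have off : ∀ i k l, D i ≠ 0 → i ≠ k → i ≠ l → k ≠ l → M k l = 0 := by
    intro i k l hi hik hil hkl
    have := h i k i l hik hil
    simpa [hik, hil, hkl, hi, hik.symm] using this
  ext k l
  rw [Matrix.smul_apply, smul_eq_mul]
  by_cases hkl : k = l
  · subst hkl
    by_cases hk : k = p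
    · subst hk
      simp [hp]
    · have := h p k p k (Ne.symm hk) (Ne.symm hk)
      simp only [diagonal_apply_eq, diagonal_apply_ne _ hk, diagonal_apply_ne _ (Ne.symm hk)]
        at this ⊢
      field_simp
      linear_combination this - h2 * D k * M p p
  rw [diagonal_apply_ne _ hkl, mul_zero]
  by_cases hp' : p ≠ k ∧ p ≠ l
  · exact off p k l hp hp'.1 hp'.2 hkl
  by_cases hq' : q ≠ k ∧ q ≠ l
  · exact off q k l hq hq'.1 hq'.2 hkl
  grind

/-- In characteristic two, a matrix contained in a three-dimensional space of pairwise
`DetOrthogonal` matrices has rank at most one. -/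
theorem isDyad_of_detOrthogonal {n : ℕ} {N A B : Matrix (Fin n) (Fin n) K} (h2 : (2 : K) = 0)
    (hNA : DetOrthogonal N A) (hNB : DetOrthogonal N B) (hAB : DetOrthogonal A B)
    (hind : ∀ x y z : K, x • N + y • A + z • B = 0 → x = 0 ∧ y = 0 ∧ z = 0) : IsDyad N := by
  refine (isDyad_or_exists_diagonal N).resolve_right ?_
  rintro ⟨P, Q, D, p, q, hP, hQ, hpq, hp, hq, rfl⟩
  have surj : ∀ X, ∃ Y, X = P * Y * Q := by
    intro X
    refine ⟨P⁻¹ * X * Q⁻¹, ?_⟩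
    rw [isUnit_iff_isUnit_det] at hP hQ
    rw [← mul_assoc, ← mul_assoc, mul_nonsing_inv _ hP, one_mul, mul_assoc,
      nonsing_inv_mul _ hQ, mul_one]
  obtain ⟨A, rfl⟩ := surj A
  obtain ⟨B, rfl⟩ := surj B
  replace hind : ∀ x y z : K, x • diagonal D + y • A + z • B = 0 → x = 0 ∧ y = 0 ∧ z = 0 := by
    intro x y z h
    refine hind x y z ?_
    simpa [mul_add, add_mul] using congrArg (fun X => P * X * Q) h
  replace hNA := fun i k j l (hik : i ≠ k) (hjl : j ≠ l) =>
    (hNA.of_mul_mul hP hQ).minor_eq_zero hik hjl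
  replace hNB := fun i k j l (hik : i ≠ k) (hjl : j ≠ l) =>
    (hNB.of_mul_mul hP hQ).minor_eq_zero hik hjl
  replace hAB := (hAB.of_mul_mul hP hQ).minor_eq_zero hpq hpq
  have comb : ∀ y z : K, y * A p q + z * B p q = 0 → y * A q p + z * B q p = 0 →
      y = 0 ∧ z = 0 := by
    intro y z h1 h3
    have := eq_smul_diagonal_of_minor_eq_zero (M := y • A + z • B) h2 hpq hp hq
      (fun i k j l hik hjl => by
        simp only [Matrix.add_apply, Matrix.smul_apply, smul_eq_mul]
        linear_combination y * hNA i k j l hik hjl + z * hNB i k j l hik hjl) h1 h3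
    refine (hind (-((y • A + z • B) p p / D p)) y z ?_).2
    rw [add_assoc, neg_smul, ← this, neg_add_cancel]
  have cross : A q p * B p q = B q p * A p q := by
    have hA := hNA p q p q hpq hpq
    have hB := hNB p q p q hpq hpq
    simp only [diagonal_apply_eq, diagonal_apply_ne _ hpq, diagonal_apply_ne _ hpq.symm]
      at hA hB
    have : D p * (A p p * B q q + A q q * B p p) = 0 := by
      linear_combination A p p * hB + B p p * hA - A p p * B p p * D q * h2
    have : A p p * B q q + A q q * B p p = 0 := by simpa [hp] using this
    linear_combination this - hAB - A p q * B q p * h2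
  have h1 := comb (-B q p) (A q p) (by linear_combination cross) (by ring)
  have h3 := comb (-B p q) (A p q) (by ring) (by linear_combination -cross)
  have := comb 1 0 (by simp [h3.2]) (by simp [h1.2])
  exact one_ne_zero this.1

/-- An injective linear map respecting `DetOrthogonal` maps dyads to dyads in characteristic two. -/
theorem isDyad_map_of_detOrthogonal {n : ℕ} (h2 : (2 : K) = 0) (hn : 2 < n)
    (f : Matrix (Fin n) (Fin n) K →ₗ[K] Matrix (Fin n) (Fin n) K) (hf : Function.Injective f)
    (h : ∀ M N, DetOrthogonal M N → DetOrthogonal (f M) (f N)) (a b : Fin n → K) :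
    IsDyad (f (vecMulVec a b)) := by
  by_cases ha : a = 0
  · exact ⟨0, 0, by simp [ha]⟩
  by_cases hb : b = 0
  · exact ⟨0, 0, by simp [hb]⟩
  obtain ⟨c, hc⟩ := exists_linearIndependent_snoc_of_lt_finrank (R := K) (v := ![b])
    (LinearIndependent.of_subsingleton 0 hb) (by simp; omega)
  obtain ⟨d, hd⟩ := exists_linearIndependent_snoc_of_lt_finrank (R := K) hc (by simpa using hn)
  refine isDyad_of_detOrthogonal h2 (h _ _ (detOrthogonal_vecMulVec a b c))
    (h _ _ (detOrthogonal_vecMulVec a b d)) (h _ _ (detOrthogonal_vecMulVec a c d)) ?_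
  intro x y z hxyz
  rw [← map_smul, ← map_smul, ← map_smul, ← map_add, ← map_add, map_eq_zero_iff f hf] at hxyz
  rw [← vecMulVec_smul, ← vecMulVec_smul, ← vecMulVec_smul, ← vecMulVec_add, ← vecMulVec_add,
    vecMulVec_eq_zero, or_iff_right ha] at hxyz
  have := Fintype.linearIndependent_iff.mp hd ![x, y, z] (by
    rw [← hxyz, Fin.sum_univ_three]
    rfl)
  exact ⟨this 0, this 1, this 2⟩

/-- Two dyads whose sum is a dyad share their column or their row, up to scaling. -/
theorem exists_smul_of_isDyad_add [Fintype ι] {a b c d : ι → K} (ha : a ≠ 0) (hb : b ≠ 0)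
    (h : IsDyad (vecMulVec a b + vecMulVec c d)) :
    (∃ e, vecMulVec c d = vecMulVec a e) ∨ ∃ e, vecMulVec c d = vecMulVec e b := by
  obtain ⟨x, y, h⟩ := h
  have h : ∀ i j, a i * b j + c i * d j = x i * y j := fun i j => congrFun (congrFun h i) j
  obtain ⟨p, hp⟩ := Function.ne_iff.mp ha
  obtain ⟨q, hq⟩ := Function.ne_iff.mp hb
  simp only [Pi.zero_apply] at hp hq
  have key : ∀ i j, (a p * c i - a i * c p) * (b q * d j - b j * d q) = 0 := by
    intro i j
    linear_combination a i * b j * h p q + c i * d j * h p q - a i * b q * h p j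
      - c i * d q * h p j + x p * y q * h i j - x p * y j * h i q
  by_cases hc : ∀ i, a p * c i - a i * c p = 0
  · refine .inl ⟨(c p / a p) • d, ?_⟩
    ext i j
    simp only [vecMulVec_apply, Pi.smul_apply, smul_eq_mul]
    field_simp
    linear_combination d j * hc i
  · push Not at hc
    obtain ⟨i, hi⟩ := hc
    refine .inr ⟨(d q / b q) • c, ?_⟩
    ext k j
    have := (mul_eq_zero.mp (key i j)).resolve_left hi
    simp only [vecMulVec_apply, Pi.smul_apply, smul_eq_mul]
    field_simp
    linear_combination c k * this

/-- The image of `T` consists of dyads with a common column. -/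
def HasCommonColumn (T : (ι → K) →ₗ[K] Matrix ι ι K) : Prop :=
  ∃ a, ∀ w, ∃ e, T w = vecMulVec a e

theorem hasCommonColumn_or [Fintype ι] (T : (ι → K) →ₗ[K] Matrix ι ι K) (hT : ∀ w, IsDyad (T w)) :
    HasCommonColumn T ∨ HasCommonColumn ((transposeLinearEquiv ι ι K K).toLinearMap ∘ₗ T) := by
  by_cases h0 : ∀ w, T w = 0
  · exact .inl ⟨0, fun w => ⟨0, by simp [h0]⟩⟩
  push Not at h0
  obtain ⟨w₀, hw₀⟩ := h0
  obtain ⟨a, b, hab⟩ := hT w₀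
  rw [hab, Ne, vecMulVec_eq_zero, not_or] at hw₀
  have dich : ∀ w, (∃ e, T w = vecMulVec a e) ∨ ∃ e, T w = vecMulVec e b := by
    intro w
    obtain ⟨c, d, hcd⟩ := hT w
    rw [hcd]
    refine exists_smul_of_isDyad_add hw₀.1 hw₀.2 ?_
    rw [← hab, ← hcd, ← map_add]
    exact hT _
  by_contra! hcon
  have h1 : ∃ w, ¬ ∃ e, T w = vecMulVec a e := by
    by_contra! h
    exact hcon.1 ⟨a, h⟩
  have h2 : ∃ w, ¬ ∃ e, T w = vecMulVec e b := by
    by_contra! h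
    refine hcon.2 ⟨b, fun w => ?_⟩
    obtain ⟨e, he⟩ := h w
    exact ⟨e, by simp [he, transpose_vecMulVec]⟩
  obtain ⟨w₁, h1⟩ := h1
  obtain ⟨w₂, h2⟩ := h2
  obtain ⟨e₁, he₁⟩ := (dich w₁).resolve_left h1
  obtain ⟨e₂, he₂⟩ := (dich w₂).resolve_right h2
  rcases dich (w₁ + w₂) with ⟨e, he⟩ | ⟨e, he⟩ <;> rw [map_add] at he
  · exact h1 ⟨e - e₂, by rw [vecMulVec_sub, ← he, ← he₂, add_sub_cancel_right]⟩
  · exact h2 ⟨e - e₁, by rw [sub_vecMulVec, ← he, ← he₁, add_sub_cancel_left]⟩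

theorem HasCommonColumn.exists_linearEquiv [Fintype ι] {T : (ι → K) →ₗ[K] Matrix ι ι K}
    (h : HasCommonColumn T) (hT : Function.Injective T) :
    ∃ (a : ι → K) (B : (ι → K) ≃ₗ[K] (ι → K)), ∀ w, T w = vecMulVec a (B w) := by
  obtain ⟨a, ha⟩ := h
  by_cases h0 : a = 0
  · refine ⟨a, .refl K _, fun w => ?_⟩
    obtain ⟨e, he⟩ := ha w
    simp [he, h0]
  obtain ⟨k, hk⟩ := Function.ne_iff.mp h0
  let B : (ι → K) →ₗ[K] (ι → K) :=
    { toFun := fun w => (a k)⁻¹ • T w k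
      map_add' := fun x y => by rw [map_add, ← smul_add]; rfl
      map_smul' := fun c x => by rw [map_smul, RingHom.id_apply, smul_comm c]; rfl }
  have hB : ∀ w, T w = vecMulVec a (B w) := by
    intro w
    obtain ⟨e, he⟩ := ha w
    ext i j
    have hk : a k ≠ 0 := hk
    simp only [B, LinearMap.coe_mk, AddHom.coe_mk, he, vecMulVec_apply, Pi.smul_apply,
      smul_eq_mul]
    field_simp
  have hinj : Function.Injective B := fun x y hxy => hT (by rw [hB, hB, hxy])
  exact ⟨a, .ofInjectiveEndo B hinj, hB⟩

/-- The restriction of `f` to the matrices supported on row `i`. -/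
def onRow [DecidableEq ι] (f : Matrix ι ι K →ₗ[K] Matrix ι ι K) (i : ι) :
    (ι → K) →ₗ[K] Matrix ι ι K where
  toFun w := f (vecMulVec (Pi.single i 1) w)
  map_add' x y := by rw [vecMulVec_add, map_add]
  map_smul' c x := by rw [vecMulVec_smul, map_smul, RingHom.id_apply]

theorem eq_zero_of_vecMulVec_single_eq [DecidableEq ι] {i j : ι} (hij : i ≠ j) {v w : ι → K}
    (h : vecMulVec (Pi.single i 1) v = vecMulVec (Pi.single j 1) w) : v = 0 := by
  ext l
  simpa [vecMulVec_apply, hij] using congrFun (congrFun h i) l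

theorem onRow_injective [DecidableEq ι] {f : Matrix ι ι K →ₗ[K] Matrix ι ι K}
    (hf : Function.Injective f) (i : ι) :
    Function.Injective (onRow f i) := by
  intro v w h
  ext l
  simpa [vecMulVec_apply] using congrFun (congrFun (hf h) i) l

theorem exists_mul_mul_of_hasCommonColumn [Fintype ι] [DecidableEq ι]
    {f : Matrix ι ι K →ₗ[K] Matrix ι ι K}
    (hf : Function.Injective f) (hd : ∀ a b, IsDyad (f (vecMulVec a b)))
    (h : ∀ i, HasCommonColumn (onRow f i)) :
    ∃ P Q : Matrix ι ι K, ∀ M, f M = P * M * Q := by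
  rcases isEmpty_or_nonempty ι with hι | ⟨⟨i₀⟩⟩
  · exact ⟨0, 0, fun M => Subsingleton.elim _ _⟩
  choose a B hB using fun i => (h i).exists_linearEquiv (onRow_injective hf i)
  have hB' : ∀ i w, f (vecMulVec (Pi.single i 1) w) = vecMulVec (a i) (B i w) := hB
  have ne_zero : ∀ i w, w ≠ 0 → a i ≠ 0 ∧ B i w ≠ 0 := by
    intro i w hw
    rw [← not_or, ← vecMulVec_eq_zero, ← hB i]
    exact (map_ne_zero_iff _ (onRow_injective hf i)).mpr hw
  have parallel : ∀ i w, ∃ c : K, B i w = c • B i₀ w := by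
    intro i w
    by_cases hi : i = i₀
    · exact ⟨1, by rw [hi, one_smul]⟩
    by_cases hw : w = 0
    · exact ⟨0, by simp [hw]⟩
    have := hd (Pi.single i₀ 1 + Pi.single i 1) w
    rw [add_vecMulVec, map_add, hB', hB'] at this
    rcases exists_smul_of_isDyad_add (ne_zero i₀ w hw).1 (ne_zero i₀ w hw).2 this with
      ⟨e, he⟩ | ⟨e, he⟩
    · rw [← (B i₀).apply_symm_apply e, ← hB', ← hB'] at he
      exact absurd (eq_zero_of_vecMulVec_single_eq hi (hf he)) hw
    · obtain ⟨k, hk⟩ := Function.ne_iff.mp (ne_zero i w hw).1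
      have hk : a i k ≠ 0 := hk
      refine ⟨e k / a i k, ?_⟩
      ext l
      have := congrFun (congrFun he k) l
      simp only [vecMulVec_apply] at this
      rw [Pi.smul_apply, smul_eq_mul]
      field_simp
      linear_combination this
  have scalar : ∀ i, ∃ c : K, ∀ w, B i w = c • B i₀ w := by
    intro i
    obtain ⟨c, hc⟩ := LinearMap.exists_eq_smul_id_of_forall_notLinearIndependent
      (f := (B i).toLinearMap ∘ₗ (B i₀).symm.toLinearMap) (fun v => by
        obtain ⟨c, hc⟩ := parallel i ((B i₀).symm v)
        rw [LinearEquiv.apply_symm_apply] at hc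
        intro hv
        have := (LinearIndependent.pair_iff.mp hv c (-1) (by simp [hc])).2
        simp at this)
    refine ⟨c, fun w => ?_⟩
    simpa using LinearMap.congr_fun hc (B i₀ w)
  choose c hc using scalar
  let P : Matrix ι ι K := of fun k i => c i * a i k
  let Q : Matrix ι ι K := (LinearMap.toMatrix' (B i₀).toLinearMap)ᵀ
  refine ⟨P, Q, fun M => ?_⟩
  have hM : M = ∑ i, vecMulVec (Pi.single i 1) (M i) := by
    ext k l
    simp [Matrix.sum_apply, vecMulVec_apply, Pi.single_apply]
  have hP : ∀ i, P *ᵥ Pi.single i 1 = c i • a i := by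
    intro i
    ext k
    simp [P]
  have hQ : ∀ w, w ᵥ* Q = B i₀ w := by
    intro w
    rw [vecMul_transpose, LinearMap.toMatrix'_mulVec]
    rfl
  rw [hM, map_sum, Finset.mul_sum, Finset.sum_mul]
  refine Finset.sum_congr rfl fun i _ => ?_
  rw [hB', hc, mul_vecMulVec, vecMulVec_mul, hP, hQ, vecMulVec_smul, smul_vecMulVec]

/-- Injective linear maps preserving matrices of rank at most one are equivalences of matrices,
possibly composed with the transposition. -/
theorem exists_mul_mul_or_transpose [Fintype ι] [DecidableEq ι]
    {f : Matrix ι ι K →ₗ[K] Matrix ι ι K}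
    (hf : Function.Injective f) (hd : ∀ a b, IsDyad (f (vecMulVec a b))) :
    ∃ P Q : Matrix ι ι K, (∀ M, f M = P * M * Q) ∨ ∀ M, f M = P * Mᵀ * Q := by
  by_cases h : ∀ i, HasCommonColumn (onRow f i)
  · obtain ⟨P, Q, hPQ⟩ := exists_mul_mul_of_hasCommonColumn hf hd h
    exact ⟨P, Q, .inl hPQ⟩
  push Not at h
  obtain ⟨j, hj⟩ := h
  let g := (transposeLinearEquiv ι ι K K).toLinearMap ∘ₗ f
  have hg : Function.Injective g := (transposeLinearEquiv ι ι K K).injective.comp hf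
  have hdg : ∀ a b, IsDyad (g (vecMulVec a b)) := by
    intro a b
    obtain ⟨c, d, h⟩ := hd a b
    exact ⟨d, c, by simp [g, h, transpose_vecMulVec]⟩
  have hgj : HasCommonColumn (onRow g j) :=
    (hasCommonColumn_or (onRow f j) fun _ => hd _ _).resolve_left hj
  have all : ∀ i, HasCommonColumn (onRow g i) := by
    intro i
    refine (hasCommonColumn_or (onRow f i) fun _ => hd _ _).resolve_left fun hi => ?_
    have hij : i ≠ j := fun e => hj (e ▸ hi)
    obtain ⟨a, B, hB⟩ := hi.exists_linearEquiv (onRow_injective hf i)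
    obtain ⟨b, C, hC⟩ := hgj.exists_linearEquiv (onRow_injective hg j)
    have hC' : ∀ w, onRow f j w = vecMulVec (C w) b := fun w => by
      rw [← transpose_vecMulVec, ← hC]
      rfl
    have h1 := hB (B.symm b)
    have h2 := hC' (C.symm a)
    rw [LinearEquiv.apply_symm_apply] at h1 h2
    have hb := eq_zero_of_vecMulVec_single_eq hij (hf (h1.trans h2.symm))
    rw [map_eq_zero_iff _ B.symm.injective] at hb
    have := onRow_injective hf j (a₁ := Pi.single j 1) (a₂ := 0) (by rw [hC', hb]; simp)
    simp at this
  obtain ⟨P, Q, hPQ⟩ := exists_mul_mul_of_hasCommonColumn hg hdg all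
  refine ⟨Qᵀ, Pᵀ, .inr fun M => ?_⟩
  rw [← transpose_transpose (f M), mul_assoc, ← transpose_mul, ← transpose_mul]
  exact congrArg transpose (hPQ M)

theorem eq_zero_of_forall_isUnit_add [Fintype ι] [DecidableEq ι] {B : Matrix ι ι K}
    (h : ∀ X : Matrix ι ι K, IsUnit X → IsUnit (X + B)) : B = 0 := by
  obtain ⟨P, Q, D, hP, hQ, rfl⟩ := exists_isUnit_mul_diagonal_mul B
  suffices D = 0 by simp [this]
  by_contra hD
  obtain ⟨i, hi⟩ := Function.ne_iff.mp hD
  have hi : D i ≠ 0 := hi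
  classical
  let E : ι → K := fun k => if D k = 0 then 1 else -D k
  have hE : IsUnit (diagonal E) := by
    rw [isUnit_iff_isUnit_det, det_diagonal, isUnit_iff_ne_zero, Finset.prod_ne_zero_iff]
    intro k _
    by_cases hk : D k = 0 <;> simp [E, hk]
  have := h _ ((hP.mul hE).mul hQ)
  rw [← add_mul, ← mul_add, diagonal_add, isUnit_iff_isUnit_det, det_mul, det_mul, det_diagonal,
    Finset.prod_eq_zero (Finset.mem_univ i) (by simp [E, hi])] at this
  simp at this

end AffinePreserver

open AffinePreserver in
/-- If `n > 2` or `|K| > 2`, every affine automorphism `u` of `Matₙ(K)` with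
`u(GLₙ(K)) = GLₙ(K)` is of the form `M ↦ P M Q` or `M ↦ P Mᵀ Q` with `P, Q` invertible. -/
theorem stmt_9 (n : ℕ) (K : Type*) [Field K] (h : 2 < n ∨ 2 < Cardinal.mk K)
    (u : Matrix (Fin n) (Fin n) K ≃ᵃ[K] Matrix (Fin n) (Fin n) K)
    (hu : u '' {M : Matrix (Fin n) (Fin n) K | IsUnit M}
        = {M : Matrix (Fin n) (Fin n) K | IsUnit M}) :
    ∃ P Q : Matrix (Fin n) (Fin n) K, IsUnit P ∧ IsUnit Q ∧
      ((∀ M, u M = P * M * Q) ∨ (∀ M, u M = P * M.transpose * Q)) := by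
  have hunit : ∀ M, IsUnit (u M) ↔ IsUnit M := fun M => by
    change u M ∈ {M : Matrix (Fin n) (Fin n) K | IsUnit M} ↔ _
    rw [← hu]
    exact u.injective.mem_set_image
  have hdet : ∀ M, (u M).det = 0 ↔ M.det = 0 := fun M => by
    simpa only [isUnit_iff_isUnit_det, isUnit_iff_ne_zero, not_not] using not_congr (hunit M)
  let f : Matrix (Fin n) (Fin n) K →ₗ[K] Matrix (Fin n) (Fin n) K := u.linear.toLinearMap
  have hf : Function.Injective f := u.linear.injective
  have hadd : ∀ A X, u (A + X) = u A + f X := fun A X => by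
    have := u.map_vadd A X
    rwa [vadd_eq_add, vadd_eq_add, add_comm, add_comm _ (u A)] at this
  have hd : ∀ a b, IsDyad (f (vecMulVec a b)) := by
    by_cases h3 : ∃ t : K, t ≠ 0 ∧ t ≠ 1
    · obtain ⟨t, ht0, ht1⟩ := h3
      refine fun a b => isDyad_of_det_add_smul_eq_zero ht0 ht1 fun A h0 h1 => ?_
      obtain ⟨A, rfl⟩ := u.surjective A
      rw [← map_smul, ← hadd, hdet]
      rw [← hadd, hdet] at h1
      rw [hdet] at h0
      exact IsDyad.det_add_smul_eq_zero ⟨a, b, rfl⟩ h0 h1 t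
    · push Not at h3
      have hn : 2 < n := by
        refine h.resolve_right fun hK => ?_
        obtain ⟨t, ht⟩ := Cardinal.exists_notMem_of_length_lt [(0 : K), 1] (by simpa using hK)
        simp only [List.mem_cons, List.not_mem_nil, or_false, not_or] at ht
        exact ht.2 (h3 t ht.1)
      have h2 : (2 : K) = 0 := by
        by_contra h2
        have := h3 2 h2
        exact one_ne_zero (α := K) (by linear_combination this)
      have hdet' : ∀ M, (u M).det = M.det := fun M => by
        by_cases hM : M.det = 0
        · rw [hM, hdet, hM]
        · rw [h3 _ hM, h3 _ (mt (hdet M).mp hM)]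
      refine isDyad_map_of_detOrthogonal h2 hn f hf fun M N hMN A => ?_
      obtain ⟨A, rfl⟩ := u.surjective A
      simpa only [← hadd, hdet'] using hMN A
  obtain ⟨P, Q, hPQ⟩ := exists_mul_mul_or_transpose hf hd
  obtain ⟨M₁, hM₁⟩ := u.linear.surjective 1
  have hPQ_unit : IsUnit P ∧ IsUnit Q := by
    obtain ⟨X, hX⟩ : ∃ X, P * X * Q = 1 := by
      rcases hPQ with hPQ | hPQ <;> exact ⟨_, (hPQ M₁).symm.trans hM₁⟩
    have := congrArg det hX
    rw [det_mul, det_mul, det_one] at this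
    simp only [isUnit_iff_isUnit_det, isUnit_iff_ne_zero]
    constructor <;> intro h0 <;> simp [h0] at this
  have hfu : ∀ M, u M = f M + u 0 := fun M => by rw [add_comm, ← hadd, zero_add]
  have hf_unit : ∀ M, IsUnit (f M) → IsUnit M := by
    intro M hM
    rw [Matrix.isUnit_iff_isUnit_det, isUnit_iff_ne_zero] at hM ⊢
    refine mt (fun h0 => ?_) hM
    rcases hPQ with hPQ | hPQ <;> simp [hPQ, h0]
  have hu0 : u 0 = 0 := eq_zero_of_forall_isUnit_add fun X hX => by
    obtain ⟨M, rfl⟩ := u.linear.surjective X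
    have := (hunit M).mpr (hf_unit M hX)
    rwa [hfu] at this
  simp only [hu0, add_zero] at hfu
  exact ⟨P, Q, hPQ_unit.1, hPQ_unit.2, by simpa only [hfu] using hPQ⟩
end
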